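/- Let R be a finite chain ring of length 2 with maximal ideal N and residue field F_q, let k ≥ 1 be an integer, and set n = 2k. Let 𝓕 be a family of submodules of the left R-module R^{2k}, each isomorphic to R^k ⊕ (R/N)^{k−1} (shape 2^k 1^{k−1}), such that any two members of 𝓕 contain a common free rank-1 submodule. Then |𝓕| ≤ ( q^{k+1} · (q^{k−1}−1)/(q−1) + 1 ) · [2k−1 choose k−1]_q. -/

import Mathlib

/-- The Gaussian binomial coefficient
`[n choose k]_q = ∏_{i=0}^{k-1} (q^{n-i} - 1) / (q^{k-i} - 1)`
(the quotient of the two integer products; it is an exact division).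
Note `[n choose 1]_q = (q^n - 1)/(q - 1)`. -/
def gaussBinom (q n k : ℕ) : ℕ :=
  (∏ i ∈ Finset.range k, (q ^ (n - i) - 1)) / ∏ i ∈ Finset.range k, (q ^ (k - i) - 1)

namespace EKR
open Module

section counting
variable {K : Type*} [Field K] [Finite K] {E : Type*} [AddCommGroup E] [Module K E] [Finite E]

set_option linter.unusedSectionVars false

instance finQ (T : Submodule K E) : Finite (E ⧸ T) :=
  Finite.of_surjective T.mkQ (Submodule.mkQ_surjective T)

theorem card_hom {A B : Type*} [AddCommGroup A] [Module K A] [AddCommGroup B] [Module K B]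
    [Finite A] [Finite B] :
    Nat.card (A →ₗ[K] B) = Nat.card K ^ (finrank K A * finrank K B) := by
  have : Module.Finite K A := Module.Finite.of_finite
  have : Module.Finite K B := Module.Finite.of_finite
  rw [Module.natCard_eq_pow_finrank (K := K), Module.finrank_linearMap]

theorem card_compl_top (P T : Submodule K E) (h : Disjoint P T) :
    Nat.card {B : Submodule K E // T ≤ B ∧ IsCompl P B}
      = Nat.card K ^ (finrank K P * (finrank K E - finrank K P - finrank K T)) := by
  have : Module.Finite K E := Module.Finite.of_finite
  obtain ⟨B0, hTB0, hB0⟩ := h.symm.exists_isCompl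
  set f0 : E →ₗ[K] P := (Submodule.isComplEquivProj P ⟨B0, hB0.symm⟩ : E →ₗ[K] P) with hf0
  have hf0P : ∀ x : P, f0 x = x := (Submodule.isComplEquivProj P ⟨B0, hB0.symm⟩).2
  have hker : ∀ (B : Submodule K E) (hB : IsCompl P B),
      LinearMap.ker (Submodule.isComplEquivProj P ⟨B, hB⟩ : E →ₗ[K] P) = B := by
    intro B hB
    have := (Submodule.isComplEquivProj P).symm_apply_apply ⟨B, hB⟩
    exact congrArg Subtype.val this
  have hf0T : ∀ x ∈ T, f0 x = 0 := by
    intro x hx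
    have : x ∈ LinearMap.ker f0 := by rw [hf0, hker]; exact hTB0 hx
    exact this
  have hq : ∀ (φ : (E ⧸ (P ⊔ T)) →ₗ[K] P) (x : E), x ∈ P ⊔ T → φ ((P ⊔ T).mkQ x) = 0 := by
    intro φ x hx
    have : (P ⊔ T).mkQ x = 0 := by simpa using hx
    rw [this, map_zero]
  have hproj : ∀ (φ : (E ⧸ (P ⊔ T)) →ₗ[K] P) (x : P), (f0 + φ.comp (P ⊔ T).mkQ) x = x := by
    intro φ x
    rw [LinearMap.add_apply, hf0P, LinearMap.comp_apply, hq φ x (Submodule.mem_sup_left x.2), add_zero]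
  let Φ : ((E ⧸ (P ⊔ T)) →ₗ[K] P) → {B : Submodule K E // T ≤ B ∧ IsCompl P B} := fun φ =>
    ⟨LinearMap.ker (f0 + φ.comp (P ⊔ T).mkQ), by
      intro x hx
      rw [LinearMap.mem_ker, LinearMap.add_apply, hf0T x hx, LinearMap.comp_apply,
        hq φ x (Submodule.mem_sup_right hx), add_zero], LinearMap.isCompl_of_proj (hproj φ)⟩
  have hbij : Function.Bijective Φ := by
    constructor
    · intro φ ψ hφψ
      have h1 : LinearMap.ker (f0 + φ.comp (P ⊔ T).mkQ) = LinearMap.ker (f0 + ψ.comp (P ⊔ T).mkQ) :=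
        congrArg Subtype.val hφψ
      have h2 : (⟨_, hproj φ⟩ : {f : E →ₗ[K] P // ∀ x : P, f x = x}) = ⟨_, hproj ψ⟩ := by
        apply (Submodule.isComplEquivProj P).symm.injective
        exact Subtype.ext h1
      have h3 := congrArg Subtype.val h2
      have h4 : φ.comp (P ⊔ T).mkQ = ψ.comp (P ⊔ T).mkQ := add_left_cancel h3
      exact (LinearMap.cancel_right (Submodule.mkQ_surjective _)).1 h4
    · rintro ⟨B, hTB, hB⟩
      set f : E →ₗ[K] P := (Submodule.isComplEquivProj P ⟨B, hB⟩ : E →ₗ[K] P) with hf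
      have hfP : ∀ x : P, f x = x := (Submodule.isComplEquivProj P ⟨B, hB⟩).2
      have hfT : ∀ x ∈ T, f x = 0 := by
        intro x hx
        have : x ∈ LinearMap.ker f := by rw [hf, hker]; exact hTB hx
        exact this
      refine ⟨(P ⊔ T).liftQ (f - f0) ?_, ?_⟩
      · rw [sup_le_iff]
        constructor
        · intro x hx
          rw [LinearMap.mem_ker, LinearMap.sub_apply, hfP ⟨x, hx⟩, hf0P ⟨x, hx⟩, sub_self]
        · intro x hx
          rw [LinearMap.mem_ker, LinearMap.sub_apply, hfT x hx, hf0T x hx, sub_self]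
      · apply Subtype.ext
        change LinearMap.ker _ = B
        rw [Submodule.liftQ_mkQ, add_sub_cancel, hf, hker]
  rw [← Nat.card_congr (Equiv.ofBijective Φ hbij), card_hom, mul_comm]
  congr 2
  have h1 := Submodule.finrank_quotient_add_finrank (P ⊔ T)
  have h2 := Submodule.finrank_sup_add_finrank_inf_eq P T
  rw [h.eq_bot, finrank_bot] at h2
  omega

theorem finrank_comap_of_le {P S : Submodule K E} (h : P ≤ S) :
    finrank K (P.comap S.subtype) = finrank K P :=
  (Submodule.comapSubtypeEquivOfLe h).finrank_eq

theorem card_compl_rel (P T S : Submodule K E) (h : Disjoint P T) (hP : P ≤ S) (hT : T ≤ S) :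
    Nat.card {B : Submodule K E // T ≤ B ∧ B ≤ S ∧ P ⊓ B = ⊥ ∧ P ⊔ B = S}
      = Nat.card K ^ (finrank K P * (finrank K S - finrank K P - finrank K T)) := by
  have hd : Disjoint (P.comap S.subtype) (T.comap S.subtype) := by
    rw [Submodule.disjoint_def] at h ⊢
    intro x hx hy
    exact Subtype.ext (h x hx hy)
  have := card_compl_top (P.comap S.subtype) (T.comap S.subtype) hd
  rw [finrank_comap_of_le hP, finrank_comap_of_le hT] at this
  rw [← this]
  have hinj := Submodule.map_injective_of_injective (f := S.subtype) S.injective_subtype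
  have hmap : ∀ Q : Submodule K E, Q ≤ S → (Q.comap S.subtype).map S.subtype = Q := by
    intro Q hQ
    rw [Submodule.map_comap_subtype, inf_eq_right.2 hQ]
  symm
  refine Nat.card_congr ⟨fun B => ⟨B.1.map S.subtype, ?_, ?_, ?_, ?_⟩,
    fun B => ⟨B.1.comap S.subtype, ?_, ?_⟩, ?_, ?_⟩
  · exact (hmap T hT).symm.le.trans (Submodule.map_mono B.2.1)
  · exact Submodule.map_subtype_le _ _
  · have := congrArg (Submodule.map S.subtype) B.2.2.inf_eq_bot
    rwa [Submodule.map_inf _ S.injective_subtype, hmap P hP, Submodule.map_bot] at this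
  · have := congrArg (Submodule.map S.subtype) B.2.2.sup_eq_top
    rwa [Submodule.map_sup, hmap P hP, Submodule.map_top, Submodule.range_subtype] at this
  · exact Submodule.comap_mono B.2.1
  · constructor
    · rw [disjoint_iff]
      apply hinj
      rw [Submodule.map_inf _ S.injective_subtype, hmap P hP, hmap _ B.2.2.1, B.2.2.2.1, Submodule.map_bot]
    · rw [codisjoint_iff]
      apply hinj
      rw [Submodule.map_sup, hmap P hP, hmap _ B.2.2.1, B.2.2.2.2, Submodule.map_top, Submodule.range_subtype]
  · intro B
    apply Subtype.ext
    exact Submodule.comap_map_eq_of_injective S.injective_subtype _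
  · intro B
    apply Subtype.ext
    exact hmap _ B.2.2.1

/-- `gI q n = 1 + q + ... + q^(n-1)`. -/
def gI (q n : ℕ) : ℕ := ∑ i ∈ Finset.range n, q ^ i

theorem card_points_top :
    Nat.card {p : Submodule K E // finrank K p = 1} = gI (Nat.card K) (finrank K E) := by
  rw [← Nat.card_congr (Projectivization.equivSubmodule K E), Projectivization.card_of_finrank K E rfl]
  rfl

theorem card_sub_le (S : Submodule K E) (j : ℕ) :
    Nat.card {p : Submodule K E // p ≤ S ∧ finrank K p = j} =
    Nat.card {p : Submodule K S // finrank K p = j} := by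
  refine Nat.card_congr ⟨fun p => ⟨p.1.comap S.subtype, ?_⟩, fun p => ⟨p.1.map S.subtype, ?_, ?_⟩, ?_, ?_⟩
  · rw [finrank_comap_of_le p.2.1, p.2.2]
  · exact Submodule.map_subtype_le _ _
  · exact (LinearEquiv.finrank_eq (Submodule.equivMapOfInjective S.subtype S.injective_subtype p.1)).symm.trans p.2
  · intro B
    apply Subtype.ext
    simp only
    rw [Submodule.map_comap_subtype, inf_eq_right.2 B.2.1]
  · intro B
    apply Subtype.ext
    exact Submodule.comap_map_eq_of_injective S.injective_subtype _

theorem card_points_le (S : Submodule K E) :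
    Nat.card {p : Submodule K E // p ≤ S ∧ finrank K p = 1} = gI (Nat.card K) (finrank K S) := by
  rw [card_sub_le, card_points_top]

theorem card_hyp_ge (D : Submodule K E) :
    Nat.card {H : Submodule K E // D ≤ H ∧ finrank K H + 1 = finrank K E}
      = gI (Nat.card K) (finrank K E - finrank K D) := by
  have : Module.Finite K E := Module.Finite.of_finite
  have : Finite (Dual K E) := Module.finite_of_finite K
  have h0 := card_points_le (K := K) (D.dualAnnihilator)
  have h1 := Subspace.finrank_add_finrank_dualAnnihilator_eq D
  rw [show finrank K E - finrank K D = finrank K D.dualAnnihilator by omega, ← h0]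
  refine Nat.card_congr (Equiv.subtypeEquiv
    ((Subspace.orderIsoFiniteDimensional (K := K) (V := E)).toEquiv.trans OrderDual.ofDual) ?_)
  intro H
  change _ ↔ H.dualAnnihilator ≤ D.dualAnnihilator ∧ finrank K H.dualAnnihilator = 1
  rw [Subspace.dualAnnihilator_le_dualAnnihilator_iff]
  have h2 := Subspace.finrank_add_finrank_dualAnnihilator_eq H
  constructor
  · rintro ⟨a, b⟩; exact ⟨a, by omega⟩
  · rintro ⟨a, b⟩; exact ⟨a, by omega⟩

theorem card_sub_ge (T : Submodule K E) (j : ℕ) :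
    Nat.card {A : Submodule K E // T ≤ A ∧ finrank K A = finrank K T + j} =
    Nat.card {p : Submodule K (E ⧸ T) // finrank K p = j} := by
  have : Module.Finite K E := Module.Finite.of_finite
  have hr : ∀ A : Submodule K E, T ≤ A → finrank K (A.map T.mkQ) + finrank K T = finrank K A := by
    intro A hA
    have h1 := LinearMap.finrank_range_add_finrank_ker (T.mkQ.domRestrict A)
    rw [LinearMap.range_domRestrict, LinearMap.ker_domRestrict, Submodule.ker_mkQ] at h1
    rw [← h1]
    congr 1
    exact (finrank_comap_of_le hA).symm
  refine Nat.card_congr ⟨fun A => ⟨A.1.map T.mkQ, ?_⟩, fun p => ⟨p.1.comap T.mkQ, ?_, ?_⟩, ?_, ?_⟩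
  · have := hr A.1 A.2.1
    have := A.2.2
    omega
  · exact Submodule.le_comap_mkQ _ _
  · have := hr _ (Submodule.le_comap_mkQ T p.1)
    rw [Submodule.map_comap_eq_of_surjective (Submodule.mkQ_surjective _), p.2] at this
    omega
  · intro A
    apply Subtype.ext
    simp only
    rw [Submodule.comap_map_mkQ, sup_eq_right.2 A.2.1]
  · intro p
    apply Subtype.ext
    exact Submodule.map_comap_eq_of_surjective (Submodule.mkQ_surjective _) _

noncomputable instance fintypeSub : Fintype (Submodule K E) := Fintype.ofFinite _

theorem gI_mul (q n : ℕ) : (q - 1 : ℝ) * gI q n = q ^ n - 1 := by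
  unfold gI; push_cast; rw [mul_comm, geom_sum_mul]

theorem gI_mul_nat (q n : ℕ) (hq : 1 ≤ q) : (q - 1) * gI q n = q ^ n - 1 := by
  have h := gI_mul q n
  have : 1 ≤ q ^ n := Nat.one_le_pow _ _ hq
  have h2 : (((q - 1) * gI q n : ℕ) : ℝ) = ((q ^ n - 1 : ℕ) : ℝ) := by
    push_cast [Nat.cast_sub hq, Nat.cast_sub this]; exact h
  exact_mod_cast h2

open Classical in
theorem card_grass (j : ℕ) : ∀ {E : Type _} [AddCommGroup E] [Module K E] [Finite E],
    Nat.card {A : Submodule K E // finrank K A = j} * ∏ i ∈ Finset.range j, (Nat.card K ^ (j - i) - 1)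
      = ∏ i ∈ Finset.range j, (Nat.card K ^ (finrank K E - i) - 1) := by
  induction j with
  | zero =>
    intro E _ _ _
    have : Module.Finite K E := Module.Finite.of_finite
    simp only [Finset.range_zero, Finset.prod_empty, mul_one]
    rw [Nat.card_eq_one_iff_unique]
    refine ⟨⟨fun a b => Subtype.ext ?_⟩, ⟨⟨⊥, finrank_bot _ _⟩⟩⟩
    rw [Submodule.finrank_eq_zero.1 a.2, Submodule.finrank_eq_zero.1 b.2]
  | succ j ih =>
    intro E _ _ _
    have : Module.Finite K E := Module.Finite.of_finite
    have hq : 1 < Nat.card K := Finite.one_lt_card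
    -- double count
    have hdc := Finset.sum_card_bipartiteAbove_eq_sum_card_bipartiteBelow
      (s := (Finset.univ.filter fun A : Submodule K E => finrank K A = j + 1))
      (t := (Finset.univ.filter fun p : Submodule K E => finrank K p = 1)) (fun A p => p ≤ A)
    have h1 : ∀ A ∈ (Finset.univ.filter fun A : Submodule K E => finrank K A = j + 1),
        (Finset.bipartiteAbove (fun A p : Submodule K E => p ≤ A)
          (Finset.univ.filter fun p : Submodule K E => finrank K p = 1) A).card
        = gI (Nat.card K) (j + 1) := by
      intro A hA
      rw [Finset.mem_filter] at hA
      rw [← hA.2, ← card_points_le A, Nat.card_eq_fintype_card, Fintype.card_subtype]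
      congr 1
      ext p
      simp [Finset.mem_bipartiteAbove, and_comm]
    set P' := ∏ i ∈ Finset.range j, (Nat.card K ^ (j - i) - 1) with hP'
    have h2 : ∀ p ∈ (Finset.univ.filter fun p : Submodule K E => finrank K p = 1),
        (Finset.bipartiteBelow (fun A p : Submodule K E => p ≤ A)
          (Finset.univ.filter fun A : Submodule K E => finrank K A = j + 1) p).card * P'
        = ∏ i ∈ Finset.range j, (Nat.card K ^ (finrank K E - (i + 1)) - 1) := by
      intro p hp
      rw [Finset.mem_filter] at hp
      have h3 := card_sub_ge p j
      have h4 := ih (E := E ⧸ p)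
      have h5 := Submodule.finrank_quotient_add_finrank p
      rw [← h3] at h4
      rw [show finrank K (E ⧸ p) = finrank K E - 1 by omega] at h4
      simp only [Nat.sub_sub, Nat.add_comm 1] at h4
      rw [← h4, Nat.card_eq_fintype_card, Fintype.card_subtype]
      congr 2
      ext A
      simp [Finset.mem_bipartiteBelow, hp.2, add_comm, and_comm]
    rw [Finset.sum_congr rfl h1, Finset.sum_const, smul_eq_mul] at hdc
    have h6 := congrArg (· * P') hdc
    try simp only at h6
    rw [Finset.sum_mul, Finset.sum_congr rfl h2, Finset.sum_const, smul_eq_mul] at h6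
    have h7 : (Finset.univ.filter fun p : Submodule K E => finrank K p = 1).card
        = gI (Nat.card K) (finrank K E) := by
      rw [← card_points_top (K := K) (E := E), Nat.card_eq_fintype_card, Fintype.card_subtype]
    have h8 : Nat.card {A : Submodule K E // finrank K A = j + 1} =
      (Finset.univ.filter fun A : Submodule K E => finrank K A = j + 1).card := by
      rw [Nat.card_eq_fintype_card, Fintype.card_subtype]
    rw [← h8, h7] at h6
    rw [Finset.prod_range_succ', Finset.prod_range_succ']
    simp only [Nat.sub_zero]
    have e1 : ∀ i, j + 1 - (i + 1) = j - i := by intro i; omega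
    simp only [e1]
    rw [← hP', ← gI_mul_nat _ _ hq.le, ← gI_mul_nat _ _ hq.le]
    calc _ = (Nat.card K - 1) * (Nat.card {A : Submodule K E // finrank K A = j + 1}
            * gI (Nat.card K) (j+1) * P') := by ring
      _ = _ := by rw [h6]; ring

theorem card_grass' (j : ℕ) :
    Nat.card {A : Submodule K E // finrank K A = j} = gaussBinom (Nat.card K) (finrank K E) j := by
  have hq : 1 < Nat.card K := Finite.one_lt_card
  unfold gaussBinom
  rw [← card_grass (K := K) (E := E) j, Nat.mul_div_cancel]
  apply Finset.prod_pos
  intro i hi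
  rw [Finset.mem_range] at hi
  have : 1 < Nat.card K ^ (j - i) := Nat.one_lt_pow (by omega) hq
  omega

end counting
end EKR

namespace EKR
open Module Matrix

section abstractpsd
variable {ι : Type*} [Fintype ι]

theorem exists_proj (S : Submodule ℝ (ι → ℝ)) (f : ι → ℝ) :
    ∃ w ∈ S, ∀ v ∈ S, v ⬝ᵥ (f - w) = 0 := by
  let e := (WithLp.linearEquiv 2 ℝ (ι → ℝ)).symm
  let S' : Submodule ℝ (EuclideanSpace ℝ ι) := S.map e.toLinearMap
  obtain ⟨y, hy, z, hz, hyz⟩ := S'.exists_add_mem_mem_orthogonal (e f)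
  obtain ⟨w, hw, rfl⟩ := hy
  refine ⟨w, hw, fun v hv => ?_⟩
  have h1 : e (f - w) = z := by
    rw [map_sub, hyz]; simp
  have h2 := hz (e v) ⟨v, hv, rfl⟩
  rw [← h1, EuclideanSpace.inner_eq_star_dotProduct] at h2
  rw [dotProduct_comm]
  simpa [e] using h2

theorem symm_dot {Q : Matrix ι ι ℝ} (hQ : Q.IsSymm) (f g : ι → ℝ) :
    f ⬝ᵥ (Q *ᵥ g) = g ⬝ᵥ (Q *ᵥ f) := by
  rw [dotProduct_mulVec, ← mulVec_transpose, hQ.eq, dotProduct_comm]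

theorem psd_filtration (Q : Matrix ι ι ℝ) (hQ : Q.IsSymm) (U : ℕ → Submodule ℝ (ι → ℝ))
    (hmono : Monotone U) (s n : ℕ) (hinv : ∀ t, ∀ v ∈ U t, Q *ᵥ v ∈ U t)
    (hpos : ∀ t, s ≤ t → t < n → ∀ v ∈ U (t+1), (∀ w ∈ U t, w ⬝ᵥ v = 0) → 0 ≤ v ⬝ᵥ (Q *ᵥ v))
    (m : ℕ) (hsm : s ≤ m) : m ≤ n → ∀ f ∈ U m, (∀ w ∈ U s, w ⬝ᵥ f = 0) → 0 ≤ f ⬝ᵥ (Q *ᵥ f) := by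
  induction m, hsm using Nat.le_induction with
  | base =>
    intro _ f hf h
    have h0 := h f hf
    rw [dotProduct_self_eq_zero] at h0
    simp [h0]
  | succ m hm ih =>
    intro hmn f hf h
    obtain ⟨w, hw, hv⟩ := exists_proj (U m) f
    set v := f - w with hvdef
    have hfv : f = v + w := by simp [hvdef]
    have hvU : v ∈ U (m+1) := Submodule.sub_mem _ hf (hmono (Nat.le_succ m) hw)
    have h1 := hpos m hm (by omega) v hvU hv
    have h2 := ih (by omega) w hw (by
      intro x hx
      have a := h x hx
      have b := hv x (hmono hm hx)
      rw [hfv, dotProduct_add, b, zero_add] at a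
      exact a)
    have h3 : v ⬝ᵥ (Q *ᵥ w) = 0 := by
      rw [dotProduct_comm]; exact hv _ (hinv m w hw)
    have h4 : w ⬝ᵥ (Q *ᵥ v) = 0 := by rw [symm_dot hQ, h3]
    rw [hfv, mulVec_add, dotProduct_add, add_dotProduct, add_dotProduct, h3, h4]
    linarith

end abstractpsd

section mobius
variable {K : Type*} [Field K] [Finite K] {E : Type*} [AddCommGroup E] [Module K E] [Finite E]
set_option linter.unusedSectionVars false
open Classical

/-- Moebius function of the subspace lattice. -/
noncomputable def mu (q j : ℕ) : ℝ := (-1) ^ j * (q : ℝ) ^ (j.choose 2)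

theorem mu_succ (q j : ℕ) : mu q (j + 1) = - (q : ℝ) ^ j * mu q j := by
  unfold mu
  rw [Nat.choose_succ_succ j 1, Nat.choose_one_right]
  ring

theorem point_inf {p B : Submodule K E} (hp : finrank K p = 1) (h : ¬ p ≤ B) : p ⊓ B = ⊥ := by
  have : Module.Finite K E := Module.Finite.of_finite
  by_contra hne
  apply h
  have h1 : 0 < finrank K (p ⊓ B : Submodule K E) := by
    rw [Nat.pos_iff_ne_zero]; intro h0; exact hne (Submodule.finrank_eq_zero.1 h0)
  have h2 : p ⊓ B = p := Submodule.eq_of_le_of_finrank_le inf_le_left (by omega)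
  exact inf_eq_left.1 h2

theorem exists_point {C : Submodule K E} (h : C ≠ ⊥) : ∃ p ≤ C, finrank K p = 1 := by
  obtain ⟨x, hx, hx0⟩ := Submodule.exists_mem_ne_zero_of_ne_bot h
  exact ⟨Submodule.span K {x}, by simpa using hx, finrank_span_singleton hx0⟩

theorem finrank_sup_of_inf {P B : Submodule K E} (h : P ⊓ B = ⊥) :
    finrank K (P ⊔ B : Submodule K E) = finrank K P + finrank K B := by
  have : Module.Finite K E := Module.Finite.of_finite
  have := Submodule.finrank_sup_add_finrank_inf_eq P B
  rw [h, finrank_bot] at this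
  omega

theorem natcard_filter (P : Submodule K E → Prop) [DecidablePred P] :
    Nat.card {B : Submodule K E // P B} = (Finset.univ.filter P).card := by
  rw [Nat.card_eq_fintype_card, Fintype.card_subtype]

theorem mob (C : Submodule K E) :
    ∑ B ∈ Finset.univ.filter (fun B : Submodule K E => B ≤ C), mu (Nat.card K) (finrank K B)
      = if C = ⊥ then 1 else 0 := by
  have : Module.Finite K E := Module.Finite.of_finite
  split_ifs with hC
  · subst hC
    have : Finset.univ.filter (fun B : Submodule K E => B ≤ ⊥) = {⊥} := by ext B; simp
    rw [this, Finset.sum_singleton, finrank_bot]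
    simp [mu]
  · obtain ⟨p, hpC, hp⟩ := exists_point hC
    rw [← Finset.sum_fiberwise _ (fun B => p ⊔ B)]
    apply Finset.sum_eq_zero
    intro S _
    by_cases hS : p ≤ S ∧ S ≤ C
    · have hset : (Finset.univ.filter (fun B : Submodule K E => B ≤ C)).filter (fun B => p ⊔ B = S)
          = insert S (Finset.univ.filter fun B => ⊥ ≤ B ∧ B ≤ S ∧ p ⊓ B = ⊥ ∧ p ⊔ B = S) := by
        ext B
        simp only [Finset.mem_filter, Finset.mem_univ, true_and, Finset.mem_insert, bot_le]
        constructor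
        · rintro ⟨h1, h2⟩
          by_cases hpB : p ≤ B
          · left; rw [← h2]; exact (sup_eq_right.2 hpB).symm
          · right; exact ⟨h2 ▸ le_sup_right, point_inf hp hpB, h2⟩
        · rintro (rfl | ⟨h1, h2, h3⟩)
          · exact ⟨hS.2, sup_eq_right.2 hS.1⟩
          · exact ⟨h1.trans hS.2, h3⟩
      have hfr : ∀ B ∈ Finset.univ.filter (fun B : Submodule K E => ⊥ ≤ B ∧ B ≤ S ∧ p ⊓ B = ⊥ ∧ p ⊔ B = S),
          mu (Nat.card K) (finrank K B) = mu (Nat.card K) (finrank K S - 1) := by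
        intro B hB
        simp only [Finset.mem_filter] at hB
        have := finrank_sup_of_inf hB.2.2.2.1
        rw [hB.2.2.2.2, hp] at this
        rw [this, Nat.add_sub_cancel_left]
      have hS1 : 1 ≤ finrank K S := hp ▸ Submodule.finrank_mono hS.1
      rw [hset, Finset.sum_insert, Finset.sum_congr rfl hfr, Finset.sum_const, ← natcard_filter,
        card_compl_rel p ⊥ S disjoint_bot_right hS.1 bot_le, finrank_bot, hp]
      · obtain ⟨j, hj⟩ := Nat.exists_eq_add_of_le' hS1
        rw [hj, mu_succ]
        simp
      · simp only [Finset.mem_filter, not_and]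
        intro _ _ _ h
        exfalso
        rw [inf_eq_left.2 hS.1] at h
        rw [h, finrank_bot] at hp
        omega
    · rw [Finset.filter_filter, Finset.filter_eq_empty_iff.2, Finset.sum_empty]
      rintro B _ ⟨h1, h2⟩
      exact hS ⟨h2 ▸ le_sup_left, h2 ▸ sup_le hpC h1⟩

theorem mob2 (T A : Submodule K E) :
    ∑ B ∈ Finset.univ.filter (fun B : Submodule K E => B ≤ T),
      mu (Nat.card K) (finrank K B) * (if B ≤ A then 1 else 0)
      = if T ⊓ A = ⊥ then 1 else 0 := by
  rw [← mob (T ⊓ A)]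
  simp only [le_inf_iff, mul_ite, mul_one, mul_zero]
  rw [← Finset.sum_filter, Finset.filter_filter]

theorem cnt_eq {k : ℕ} (hE : finrank K E = 2 * k) (A : Submodule K E) (hA : finrank K A = k)
    (T : Submodule K E) :
    ((Finset.univ.filter fun A' : Submodule K E => finrank K A' = k ∧ T ≤ A' ∧ A ⊓ A' = ⊥).card : ℝ)
      = (Nat.card K : ℝ) ^ (k * (k - finrank K T)) *
        ∑ B ∈ Finset.univ.filter (fun B : Submodule K E => B ≤ T),
          mu (Nat.card K) (finrank K B) * (if B ≤ A then 1 else 0) := by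
  have : Module.Finite K E := Module.Finite.of_finite
  rw [mob2]
  split_ifs with h
  · have h1 := card_compl_rel A T ⊤ (disjoint_iff.2 (by rw [inf_comm]; exact h)) le_top le_top
    rw [natcard_filter, finrank_top, hE, hA] at h1
    have h2 : (Finset.univ.filter fun A' : Submodule K E => finrank K A' = k ∧ T ≤ A' ∧ A ⊓ A' = ⊥)
      = Finset.univ.filter fun B => T ≤ B ∧ B ≤ ⊤ ∧ A ⊓ B = ⊥ ∧ A ⊔ B = ⊤ := by
      ext B
      simp only [Finset.mem_filter, Finset.mem_univ, true_and, le_top]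
      constructor
      · rintro ⟨a, b, c⟩
        refine ⟨b, c, ?_⟩
        apply Submodule.eq_top_of_finrank_eq
        rw [finrank_sup_of_inf c]; omega
      · rintro ⟨a, b, c⟩
        refine ⟨?_, a, b⟩
        have := finrank_sup_of_inf b
        rw [c, finrank_top] at this; omega
    rw [h2, h1]
    push_cast
    rw [mul_one]
    congr 2
    congr 1; omega
  · rw [mul_zero, Nat.cast_eq_zero, Finset.card_eq_zero, Finset.filter_eq_empty_iff]
    rintro B _ ⟨a, b, c⟩
    apply h
    rw [eq_bot_iff, ← c, inf_comm]
    exact inf_le_inf_left _ b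

end mobius
end EKR

namespace EKR
open Module Matrix

section levels
variable {K : Type*} [Field K] [Finite K] {E : Type*} [AddCommGroup E] [Module K E] [Finite E]
set_option linter.unusedSectionVars false
open Classical

/-- Indicator of the members of `P` containing `T`. -/
noncomputable def chi (P : Submodule K E → Prop) (T : Submodule K E) : {A // P A} → ℝ :=
  fun A => if T ≤ A.1 then 1 else 0

/-- Span of the `chi T` with `T` of dimension less than `t`. -/
noncomputable def lvl (P : Submodule K E → Prop) (t : ℕ) : Submodule ℝ ({A // P A} → ℝ) :=
  Submodule.span ℝ {f | ∃ T : Submodule K E, finrank K T < t ∧ f = chi P T}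

/-- Disjointness matrix. -/
noncomputable def kn (P : Submodule K E → Prop) : Matrix {A // P A} {A // P A} ℝ :=
  fun A B => if A.1 ⊓ B.1 = ⊥ then 1 else 0

variable (P : Submodule K E → Prop)

theorem chi_mem {T : Submodule K E} {t : ℕ} (h : finrank K T < t) : chi P T ∈ lvl P t :=
  Submodule.subset_span ⟨T, h, rfl⟩

theorem lvl_mono : Monotone (lvl P) := by
  intro s t h
  apply Submodule.span_mono
  rintro f ⟨T, hT, rfl⟩
  exact ⟨T, hT.trans_le h, rfl⟩

theorem lvl_map (Q : Matrix {A // P A} {A // P A} ℝ) (S : Submodule ℝ ({A // P A} → ℝ)) (t : ℕ)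
    (h : ∀ T : Submodule K E, finrank K T < t → Q *ᵥ chi P T ∈ S) : ∀ v ∈ lvl P t, Q *ᵥ v ∈ S := by
  intro v hv
  induction hv using Submodule.span_induction with
  | mem x hx => obtain ⟨T, hT, rfl⟩ := hx; exact h T hT
  | zero => simp
  | add x y _ _ hx hy => rw [mulVec_add]; exact S.add_mem hx hy
  | smul a x _ hx => rw [mulVec_smul]; exact S.smul_mem a hx

theorem lvl_zero : lvl P 0 = ⊥ := by
  rw [lvl, Submodule.span_eq_bot]
  rintro f ⟨T, hT, rfl⟩
  omega

theorem chi_bot : chi P ⊥ = 1 := by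
  ext A; simp [chi]

theorem lvl_top {k : ℕ} (hP : ∀ A, P A → finrank K A = k) (f : {A // P A} → ℝ) :
    f ∈ lvl P (k+1) := by
  have : Module.Finite K E := Module.Finite.of_finite
  have : f = ∑ A, f A • chi P A.1 := by
    ext B
    rw [Finset.sum_apply, Finset.sum_eq_single B]
    · simp [chi]
    · intro A _ hA
      have : ¬ A.1 ≤ B.1 := by
        intro h
        exact hA (Subtype.ext (Submodule.eq_of_le_of_finrank_eq h (by rw [hP _ A.2, hP _ B.2])))
      simp [chi, this]
    · simp
  rw [this]
  exact Submodule.sum_mem _ fun A _ => Submodule.smul_mem _ _ (chi_mem P (by rw [hP _ A.2]; omega))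

theorem sum_sub (f : Submodule K E → ℝ) :
    ∑ A : {A // P A}, f A.1 = ∑ A ∈ Finset.univ.filter P, f A :=
  (Finset.sum_subtype _ (by simp) _).symm

theorem sum_bool_sub (S : Submodule K E → Prop) [DecidablePred S] :
    ∑ A : {A // P A}, (if S A.1 then (1:ℝ) else 0)
      = ((Finset.univ.filter fun A => P A ∧ S A).card : ℝ) := by
  rw [sum_sub P (fun A => if S A then (1:ℝ) else 0), Finset.sum_boole, Finset.filter_filter]

theorem kn_symm : (kn P).IsSymm := by
  ext A B
  simp only [transpose_apply, kn, inf_comm]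

/-- If `Q` sends each `chi T`, `dim T ≤ t`, into level `t`, its form vanishes on the layer. -/
theorem form_layer (Q : Matrix {A // P A} {A // P A} ℝ) (t : ℕ)
    (h : ∀ T : Submodule K E, finrank K T < t + 1 → Q *ᵥ chi P T ∈ lvl P t)
    (v : {A // P A} → ℝ) (hv : v ∈ lvl P (t+1)) (ho : ∀ w ∈ lvl P t, w ⬝ᵥ v = 0) :
    v ⬝ᵥ (Q *ᵥ v) = 0 := by
  rw [dotProduct_comm]
  exact ho _ (lvl_map P Q _ _ h v hv)

theorem bool_mul (p r : Prop) [Decidable p] [Decidable r] : (if p then (1:ℝ) else 0) * (if r then 1 else 0)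
    = if r ∧ p then 1 else 0 := by
  by_cases p <;> by_cases r <;> simp [*]

end levels

section kneser
variable {K : Type*} [Field K] [Finite K] {E : Type*} [AddCommGroup E] [Module K E] [Finite E]
set_option linter.unusedSectionVars false
open Classical

/-- The predicate of being `k`-dimensional. -/
def isK (K : Type*) [Field K] {E : Type*} [AddCommGroup E] [Module K E] (k : ℕ) (A : Submodule K E) : Prop :=
  finrank K A = k

theorem kn_chi {k : ℕ} (hE : finrank K E = 2 * k) (T : Submodule K E) :
    kn (isK K k) *ᵥ chi (isK K k) T = (Nat.card K : ℝ) ^ (k * (k - finrank K T)) •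
      ∑ B ∈ Finset.univ.filter (fun B : Submodule K E => B ≤ T),
          mu (Nat.card K) (finrank K B) • chi (isK K k) B := by
  ext A
  have h := cnt_eq hE A.1 A.2 T
  simp only [mulVec, dotProduct, kn, chi, bool_mul]
  rw [sum_bool_sub (isK K k) (fun A' => T ≤ A' ∧ A.1 ⊓ A' = ⊥)]
  rw [Pi.smul_apply, Finset.sum_apply]
  simp only [Pi.smul_apply, smul_eq_mul]
  convert h using 4
  · exact Iff.rfl
  · rfl

theorem mob_split (P : Submodule K E → Prop) (T : Submodule K E) (c : Submodule K E → ℝ) :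
    (∑ B ∈ Finset.univ.filter (fun B : Submodule K E => B ≤ T), c B • chi P B) - c T • chi P T
      ∈ lvl P (finrank K T) := by
  have : Module.Finite K E := Module.Finite.of_finite
  have hm : T ∈ Finset.univ.filter (fun B : Submodule K E => B ≤ T) := by simp
  rw [← Finset.add_sum_erase _ _ hm, add_sub_cancel_left]
  refine Submodule.sum_mem _ fun B hB => Submodule.smul_mem _ _ (chi_mem _ ?_)
  simp only [Finset.mem_erase, Finset.mem_filter] at hB
  exact Submodule.finrank_lt_finrank_of_lt (lt_of_le_of_ne hB.2.2 hB.1)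

theorem kn_layer {k : ℕ} (hE : finrank K E = 2 * k) (T : Submodule K E) :
    kn (isK K k) *ᵥ chi (isK K k) T
      - ((Nat.card K : ℝ) ^ (k * (k - finrank K T)) * mu (Nat.card K) (finrank K T)) • chi (isK K k) T
      ∈ lvl (isK K k) (finrank K T) := by
  rw [kn_chi hE, mul_smul, ← smul_sub]
  exact Submodule.smul_mem _ _ (mob_split _ T _)

theorem kn_inv {k : ℕ} (hE : finrank K E = 2 * k) (t : ℕ) :
    ∀ v ∈ lvl (isK K k) t, kn (isK K k (E := E)) *ᵥ v ∈ lvl (isK K k) t := by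
  apply lvl_map
  intro T hT
  have h := lvl_mono _ hT.le (kn_layer hE T)
  have := Submodule.add_mem _ h (Submodule.smul_mem _ ((Nat.card K : ℝ) ^ (k * (k - finrank K T)) * mu (Nat.card K) (finrank K T)) (chi_mem (isK K k) hT))
  simpa using this

theorem kn_form {k : ℕ} (hE : finrank K E = 2 * k) (t : ℕ)
    (v : {A : Submodule K E // isK K k A} → ℝ) (hv : v ∈ lvl (isK K k) (t+1))
    (ho : ∀ w ∈ lvl (isK K k) t, w ⬝ᵥ v = 0) :
    v ⬝ᵥ (kn (isK K k) *ᵥ v) = ((Nat.card K : ℝ) ^ (k * (k - t)) * mu (Nat.card K) t) * (v ⬝ᵥ v) := by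
  have h := form_layer (isK K k) (kn (isK K k) - ((Nat.card K : ℝ) ^ (k * (k - t)) * mu (Nat.card K) t) • 1) t
    (by
      intro T hT
      rw [sub_mulVec, smul_mulVec, one_mulVec]
      rcases Nat.lt_succ_iff_lt_or_eq.1 hT with h | rfl
      · exact Submodule.sub_mem _ (kn_inv hE t _ (chi_mem _ h)) (Submodule.smul_mem _ _ (chi_mem _ h))
      · exact kn_layer hE T) v hv ho
  rw [sub_mulVec, smul_mulVec, one_mulVec, dotProduct_sub, dotProduct_smul, smul_eq_mul] at h
  linarith

end kneser
end EKR

namespace EKR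
open Module Matrix

section counting
variable {K : Type*} [Field K] [Finite K] {E : Type*} [AddCommGroup E] [Module K E] [Finite E]
set_option linter.unusedSectionVars false
open Classical

theorem gI_pos (q : ℕ) {n : ℕ} (hn : 1 ≤ n) : 1 ≤ gI q n := by
  unfold gI
  obtain ⟨m, rfl⟩ := Nat.exists_eq_add_of_le' hn
  rw [Finset.sum_range_succ']
  simp

theorem gI_add (q m n : ℕ) : gI q (m + n) = gI q m + q ^ m * gI q n := by
  unfold gI
  rw [Finset.sum_range_add, Finset.mul_sum]
  simp [pow_add]

theorem gI_two (q k : ℕ) : gI q (2 * k) = gI q k * (q ^ k + 1) := by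
  rw [two_mul, gI_add]; ring

theorem cnt_all (k : ℕ) : (Finset.univ.filter fun A : Submodule K E => finrank K A = k).card
    = gaussBinom (Nat.card K) (finrank K E) k := by
  rw [← card_grass', natcard_filter]

theorem cnt_ge (T : Submodule K E) (k : ℕ) (h : finrank K T ≤ k) :
    (Finset.univ.filter fun A : Submodule K E => finrank K A = k ∧ T ≤ A).card
    = gaussBinom (Nat.card K) (finrank K E - finrank K T) (k - finrank K T) := by
  have : Module.Finite K E := Module.Finite.of_finite
  have : Finite (E ⧸ T) := finQ T
  have h1 := card_sub_ge T (k - finrank K T)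
  rw [card_grass', natcard_filter] at h1
  have h2 := T.finrank_quotient_add_finrank
  rw [show finrank K (E ⧸ T) = finrank K E - finrank K T by omega] at h1
  rw [← h1]
  congr 1
  ext A
  simp only [Finset.mem_filter, Finset.mem_univ, true_and]
  rw [and_comm]
  apply and_congr_right
  intro _
  omega

theorem cnt_points (A : Submodule K E) :
    (Finset.univ.filter fun p : Submodule K E => p ≤ A ∧ finrank K p = 1).card
      = gI (Nat.card K) (finrank K A) := by
  rw [← card_points_le, natcard_filter]

theorem flag_count {k : ℕ} (hk : 1 ≤ k) :
    gaussBinom (Nat.card K) (finrank K E) k * gI (Nat.card K) k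
      = gI (Nat.card K) (finrank K E) * gaussBinom (Nat.card K) (finrank K E - 1) (k - 1) := by
  have := Finset.sum_card_bipartiteAbove_eq_sum_card_bipartiteBelow (fun (A p : Submodule K E) => p ≤ A)
    (s := Finset.univ.filter fun A : Submodule K E => finrank K A = k)
    (t := Finset.univ.filter fun p : Submodule K E => finrank K p = 1)
  rw [Finset.sum_congr rfl (g := fun _ => gI (Nat.card K) k), Finset.sum_const,
    Finset.sum_congr (s₁ := Finset.univ.filter fun p : Submodule K E => finrank K p = 1) rfl (g := fun _ => gaussBinom (Nat.card K) (finrank K E - 1) (k - 1)),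
    Finset.sum_const, cnt_all] at this
  · have h := cnt_points (⊤ : Submodule K E)
    simp only [le_top, true_and, finrank_top] at h
    rw [h] at this
    exact this
  · intro p hp
    simp only [Finset.mem_filter, Finset.mem_univ, true_and] at hp
    have h := cnt_ge p k (by omega)
    rw [hp] at h
    rw [← h, Finset.bipartiteBelow, Finset.filter_filter]
  · intro A hA
    simp only [Finset.mem_filter, Finset.mem_univ, true_and] at hA
    rw [← hA, ← cnt_points, Finset.bipartiteAbove, Finset.filter_filter]
    simp only [and_comm]

theorem Nq_eq {k : ℕ} (hk : 1 ≤ k) (hE : finrank K E = 2 * k) :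
    gaussBinom (Nat.card K) (2 * k) k
      = (Nat.card K ^ k + 1) * gaussBinom (Nat.card K) (2 * k - 1) (k - 1) := by
  have h := flag_count (K := K) (E := E) hk
  rw [hE, gI_two] at h
  have h1 := gI_pos (Nat.card K) hk
  apply Nat.eq_of_mul_eq_mul_right h1
  rw [h]; ring

end counting

section ione
variable {K : Type*} [Field K] [Finite K] {E : Type*} [AddCommGroup E] [Module K E] [Finite E]
set_option linter.unusedSectionVars false
open Classical

/-- `k`-dimensional and not containing `L`. -/
def isU (L : Submodule K E) (k : ℕ) (A : Submodule K E) : Prop := finrank K A = k ∧ ¬ L ≤ A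

/-- Same join with `L`. -/
noncomputable def eM (L : Submodule K E) (k : ℕ) : Matrix {A // isU L k A} {A // isU L k A} ℝ :=
  fun A B => if A.1 ⊔ L = B.1 ⊔ L then 1 else 0

theorem chi_zero_of_le {L : Submodule K E} {k : ℕ} {T : Submodule K E} (h : L ≤ T) :
    chi (isU L k) T = 0 := by
  ext A
  simp only [chi, Pi.zero_apply, ite_eq_right_iff]
  intro h1
  exact absurd (h.trans h1) A.2.2

theorem chi_zero_of_lt {L : Submodule K E} {k : ℕ} {T : Submodule K E} (h : k < finrank K T) :
    chi (isU L k) T = 0 := by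
  have : Module.Finite K E := Module.Finite.of_finite
  ext A
  simp only [chi, Pi.zero_apply, ite_eq_right_iff]
  intro h1
  have := Submodule.finrank_mono h1
  rw [A.2.1] at this
  omega

theorem card_U {k : ℕ} (hk : 1 ≤ k) (hE : finrank K E = 2 * k) {L : Submodule K E} (hL : finrank K L = 1) :
    Fintype.card {A // isU L k A} = Nat.card K ^ k * gaussBinom (Nat.card K) (2 * k - 1) (k - 1) := by
  have h1 := cnt_all (K := K) (E := E) k
  have h2 := cnt_ge L k (by omega)
  rw [hE, Nq_eq hk hE] at h1
  rw [hL, hE] at h2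
  rw [Fintype.card_subtype]
  have h3 := Finset.card_filter_add_card_filter_not (s := Finset.univ.filter fun A : Submodule K E => finrank K A = k)
    (fun A => L ≤ A)
  rw [Finset.filter_filter, Finset.filter_filter, h2, h1] at h3
  have h5 : (Finset.univ.filter fun A : Submodule K E => isU L k A).card = (Finset.univ.filter fun A : Submodule K E => finrank K A = k ∧ ¬ L ≤ A).card := by
    congr 1
    ext A
    rw [Finset.mem_filter, Finset.mem_filter]
    exact Iff.rfl
  rw [h5]
  have : (Nat.card K ^ k + 1) * gaussBinom (Nat.card K) (2 * k - 1) (k - 1) = Nat.card K ^ k * gaussBinom (Nat.card K) (2 * k - 1) (k - 1) + gaussBinom (Nat.card K) (2 * k - 1) (k - 1) := by ring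
  omega

theorem eM_symm (L : Submodule K E) (k : ℕ) : (eM L k).IsSymm := by
  ext A B
  simp only [transpose_apply, eM, eq_comm]

/-- number of members of `isU` above `T` in the block of `A`. -/
theorem eM_chi {k : ℕ} {L : Submodule K E} (hL : finrank K L = 1) (T : Submodule K E)
    (hT : L ⊓ T = ⊥) (A : {A // isU L k A}) :
    (eM L k *ᵥ chi (isU L k) T) A =
      (Nat.card K : ℝ) ^ (k - finrank K T) * (if T ≤ A.1 ⊔ L then 1 else 0) := by
  have : Module.Finite K E := Module.Finite.of_finite
  have hA := finrank_sup_of_inf (point_inf hL A.2.2)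
  rw [sup_comm, hL, A.2.1] at hA
  simp only [mulVec, dotProduct, eM, chi, bool_mul]
  rw [sum_bool_sub (isU L k) (fun A' => T ≤ A' ∧ A.1 ⊔ L = A' ⊔ L)]
  split_ifs with h
  · have h1 := card_compl_rel L T (A.1 ⊔ L) (disjoint_iff.2 hT) le_sup_right h
    rw [natcard_filter, hL, hA, one_mul] at h1
    rw [mul_one, show k - finrank K T = 1 + k - 1 - finrank K T by omega]
    rw [← Nat.cast_pow, ← h1]
    congr 2
    ext B
    rw [Finset.mem_filter, Finset.mem_filter]
    simp only [Finset.mem_univ, true_and, isU]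
    constructor
    · rintro ⟨⟨h1, h2⟩, h3, h4⟩
      refine ⟨h3, h4 ▸ le_sup_left, point_inf hL h2, by rw [h4, sup_comm]⟩
    · rintro ⟨h1, h2, h3, h4⟩
      refine ⟨⟨?_, ?_⟩, h1, by rw [← h4, sup_comm]⟩
      · have := finrank_sup_of_inf h3
        rw [h4] at this; omega
      · intro h5
        rw [inf_eq_left.2 h5] at h3
        rw [h3, finrank_bot] at hL
        omega
  · rw [mul_zero, Nat.cast_eq_zero, Finset.card_eq_zero, Finset.filter_eq_empty_iff]
    rintro B _ ⟨a, b, c⟩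
    apply h
    rw [c]
    exact b.trans le_sup_left

/-- The `t`-dimensional complements of `L` in `T ⊔ L`. -/
noncomputable def cs (L T : Submodule K E) : Finset (Submodule K E) :=
  Finset.univ.filter fun B => B ≤ T ⊔ L ∧ finrank K B = finrank K T ∧ ¬ L ≤ B

theorem cs_sum {k : ℕ} {L : Submodule K E} (hL : finrank K L = 1) (T : Submodule K E)
    (hT : L ⊓ T = ⊥) (A : {A // isU L k A}) :
    ∑ B ∈ cs L T, chi (isU L k) B A = if T ≤ A.1 ⊔ L then 1 else 0 := by
  have : Module.Finite K E := Module.Finite.of_finite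
  have hTL := finrank_sup_of_inf hT
  rw [sup_comm, hL] at hTL
  split_ifs with h
  · have hsup : T ⊔ L ≤ A.1 ⊔ L := sup_le h le_sup_right
    set B0 := (T ⊔ L) ⊓ A.1 with hB0
    have hLB : L ⊓ B0 = ⊥ := by
      rw [eq_bot_iff, ← point_inf hL A.2.2]
      exact inf_le_inf_left _ inf_le_right
    have hs : L ⊔ B0 = T ⊔ L := by
      rw [hB0, inf_comm, ← sup_inf_assoc_of_le _ le_sup_right, sup_comm, inf_eq_right]
      exact hsup
    have hf := finrank_sup_of_inf hLB
    rw [hs, hTL, hL] at hf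
    have hf' : finrank K B0 = finrank K T := by omega
    rw [Finset.sum_eq_single B0]
    · simp [chi, hB0]
    · intro B hB hne
      simp only [cs, Finset.mem_filter, Finset.mem_univ, true_and] at hB
      simp only [chi, ite_eq_right_iff, one_ne_zero, imp_false]
      intro h2
      apply hne
      apply Submodule.eq_of_le_of_finrank_eq (le_inf hB.1 h2)
      rw [hB.2.1, ← hf']
    · intro hn
      exfalso
      apply hn
      simp only [cs, Finset.mem_filter, Finset.mem_univ, true_and]
      refine ⟨inf_le_left, hf', fun h => A.2.2 (h.trans inf_le_right)⟩
  · apply Finset.sum_eq_zero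
    intro B hB
    simp only [cs, Finset.mem_filter, Finset.mem_univ, true_and] at hB
    simp only [chi, ite_eq_right_iff, one_ne_zero, imp_false]
    intro h2
    apply h
    have h3 := finrank_sup_of_inf (point_inf hL hB.2.2)
    have h4 : L ⊔ B = T ⊔ L := by
      apply Submodule.eq_of_le_of_finrank_eq (sup_le le_sup_right hB.1)
      rw [h3, hL, hB.2.1, hTL]
    calc T ≤ T ⊔ L := le_sup_left
      _ = L ⊔ B := h4.symm
      _ ≤ A.1 ⊔ L := sup_le le_sup_right (h2.trans le_sup_left)

theorem eM_chi' {k : ℕ} {L : Submodule K E} (hL : finrank K L = 1) (T : Submodule K E)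
    (hT : L ⊓ T = ⊥) :
    eM L k *ᵥ chi (isU L k) T =
      (Nat.card K : ℝ) ^ (k - finrank K T) • ∑ B ∈ cs L T, chi (isU L k) B := by
  ext A
  rw [eM_chi hL T hT, ← cs_sum hL T hT, Pi.smul_apply, Finset.sum_apply, smul_eq_mul]

theorem eM_mem {k : ℕ} {L : Submodule K E} (hL : finrank K L = 1) (T : Submodule K E) :
    eM L k *ᵥ chi (isU L k) T ∈ lvl (isU L k) (finrank K T + 1) := by
  by_cases hT : L ≤ T
  · rw [chi_zero_of_le hT, mulVec_zero]; exact Submodule.zero_mem _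
  · rw [eM_chi' hL T (point_inf hL hT)]
    refine Submodule.smul_mem _ _ (Submodule.sum_mem _ fun B hB => chi_mem _ ?_)
    simp only [cs, Finset.mem_filter, Finset.mem_univ, true_and] at hB
    omega

/-- the coefficient -/
noncomputable def cc (q k t : ℕ) : ℝ := if t < k then (q : ℝ) ^ (k * (k - (t + 1))) else 0

theorem knU_chi {k : ℕ} (hE : finrank K E = 2 * k) {L : Submodule K E} (hL : finrank K L = 1)
    (T : Submodule K E) (hT : L ⊓ T = ⊥) (hk : finrank K T ≤ k) :
    kn (isU L k) *ᵥ chi (isU L k) T = (Nat.card K : ℝ) ^ (k * (k - finrank K T)) •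
      ∑ B ∈ Finset.univ.filter (fun B : Submodule K E => B ≤ T),
          mu (Nat.card K) (finrank K B) • chi (isU L k) B
      - cc (Nat.card K) k (finrank K T) • 
      ∑ B ∈ Finset.univ.filter (fun B : Submodule K E => B ≤ T ⊔ L),
          mu (Nat.card K) (finrank K B) • chi (isU L k) B := by
  have : Module.Finite K E := Module.Finite.of_finite
  have hTL := finrank_sup_of_inf hT
  rw [sup_comm, hL] at hTL
  ext A
  have h := cnt_eq hE A.1 A.2.1 T
  have h' := cnt_eq hE A.1 A.2.1 (T ⊔ L)
  simp only [mulVec, dotProduct, kn, chi, bool_mul]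
  rw [sum_bool_sub (isU L k) (fun A' => T ≤ A' ∧ A.1 ⊓ A' = ⊥)]
  rw [Pi.sub_apply, Pi.smul_apply, Finset.sum_apply, Pi.smul_apply, Finset.sum_apply]
  simp only [Pi.smul_apply, smul_eq_mul, chi]
  rw [← h]
  have h2 : cc (Nat.card K) k (finrank K T) * ∑ B ∈ Finset.univ.filter (fun B : Submodule K E => B ≤ T ⊔ L),
          mu (Nat.card K) (finrank K B) * (if B ≤ A.1 then 1 else 0) = 
      ((Finset.univ.filter fun A' : Submodule K E => finrank K A' = k ∧ T ⊔ L ≤ A' ∧ A.1 ⊓ A' = ⊥).card : ℝ) := by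
    by_cases hlt : finrank K T < k
    · rw [h', cc, if_pos hlt, hTL, add_comm 1]
    · rw [cc, if_neg hlt, zero_mul, eq_comm, Nat.cast_eq_zero, Finset.card_eq_zero, Finset.filter_eq_empty_iff]
      rintro B _ ⟨a, b, c⟩
      have := Submodule.finrank_mono b
      omega
  rw [h2, eq_sub_iff_add_eq, ← Nat.cast_add, Nat.cast_inj, add_comm]
  have h3 := Finset.card_filter_add_card_filter_not (s := Finset.univ.filter fun A' : Submodule K E => finrank K A' = k ∧ T ≤ A' ∧ A.1 ⊓ A' = ⊥)
    (fun A => L ≤ A)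
  rw [← h3, Finset.filter_filter, Finset.filter_filter]
  congr 2
  · ext B
    simp only [Finset.mem_filter, Finset.mem_univ, true_and, sup_le_iff]
    tauto
  · ext B
    rw [Finset.mem_filter, Finset.mem_filter]
    simp only [Finset.mem_univ, true_and, isU]
    tauto

theorem mobU_split {k : ℕ} {L : Submodule K E} (hL : finrank K L = 1)
    (T : Submodule K E) (hT : L ⊓ T = ⊥) :
    (∑ B ∈ Finset.univ.filter (fun B : Submodule K E => B ≤ T ⊔ L),
          mu (Nat.card K) (finrank K B) • chi (isU L k) B)
      - mu (Nat.card K) (finrank K T) • ∑ B ∈ cs L T, chi (isU L k) B ∈ lvl (isU L k) (finrank K T) := by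
  have : Module.Finite K E := Module.Finite.of_finite
  have hTL := finrank_sup_of_inf hT
  rw [sup_comm, hL] at hTL
  have hsub : cs L T ⊆ Finset.univ.filter (fun B : Submodule K E => B ≤ T ⊔ L) := by
    intro B; simp only [cs, Finset.mem_filter, Finset.mem_univ, true_and]; tauto
  rw [← Finset.sum_sdiff hsub]
  have : mu (Nat.card K) (finrank K T) • ∑ B ∈ cs L T, chi (isU L k) B
     = ∑ B ∈ cs L T, mu (Nat.card K) (finrank K B) • chi (isU L k) B := by
    rw [Finset.smul_sum]
    apply Finset.sum_congr rfl
    intro B hB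
    simp only [cs, Finset.mem_filter, Finset.mem_univ, true_and] at hB
    rw [hB.2.1]
  rw [this, add_sub_cancel_right]
  refine Submodule.sum_mem _ fun B hB => Submodule.smul_mem _ _ ?_
  simp only [cs, Finset.mem_sdiff, Finset.mem_filter, Finset.mem_univ, true_and, not_and, not_not] at hB
  by_cases hLB : L ≤ B
  · rw [chi_zero_of_le hLB]; exact Submodule.zero_mem _
  · apply chi_mem
    have h1 : finrank K B ≠ finrank K T := fun h => hLB (hB.2 hB.1 h)
    have h2 := Submodule.finrank_mono (sup_le (le_sup_right : L ≤ T ⊔ L) hB.1)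
    rw [finrank_sup_of_inf (point_inf hL hLB), hTL, hL] at h2
    omega

theorem knU_layer {k : ℕ} (hE : finrank K E = 2 * k) {L : Submodule K E} (hL : finrank K L = 1)
    (T : Submodule K E) :
    kn (isU L k) *ᵥ chi (isU L k) T
     - ((Nat.card K : ℝ) ^ (k * (k - finrank K T)) * mu (Nat.card K) (finrank K T)) • chi (isU L k) T
     + (cc (Nat.card K) k (finrank K T) * mu (Nat.card K) (finrank K T) / (Nat.card K : ℝ) ^ (k - finrank K T)) •
       (eM L k *ᵥ chi (isU L k) T) ∈ lvl (isU L k) (finrank K T) := by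
  have : Module.Finite K E := Module.Finite.of_finite
  by_cases hT : L ≤ T
  · rw [chi_zero_of_le hT]; simp
  by_cases hk : finrank K T ≤ k
  swap
  · rw [chi_zero_of_lt (by omega)]; simp
  have hT := point_inf hL hT
  rw [knU_chi hE hL T hT hk, eM_chi' hL T hT]
  have hq : (Nat.card K : ℝ) ^ (k - finrank K T) ≠ 0 := by
    have : Nat.card K ≠ 0 := Nat.card_pos.ne'
    positivity
  have h1 := Submodule.smul_mem _ ((Nat.card K : ℝ) ^ (k * (k - finrank K T))) (mob_split (isU L k) T (fun B => mu (Nat.card K) (finrank K B)))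
  have h2 := Submodule.smul_mem _ (cc (Nat.card K) k (finrank K T)) (mobU_split (k := k) hL T hT)
  have h3 := Submodule.sub_mem _ h1 h2
  rw [smul_smul, div_mul_cancel₀ _ hq]
  convert h3 using 1
  module

end ione
end EKR

namespace EKR
open Module Matrix

theorem num_choose {k t : ℕ} (hk : 2 ≤ k) (ht : 2 ≤ t) (htk : t ≤ k) :
    k * (k - t) + t.choose 2 + 1 ≤ k * (k - 1) := by
  obtain ⟨d, rfl⟩ := Nat.exists_eq_add_of_le htk
  obtain ⟨s, rfl⟩ := Nat.exists_eq_add_of_le ht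
  have h : (2 + s).choose 2 * 2 = (2 + s) * (1 + s) := by
    have := Nat.choose_two_right (2 + s)
    rw [this, Nat.div_mul_cancel]
    · congr 1; omega
    · exact (Nat.even_mul_pred_self _).two_dvd
  rw [show 2 + s + d - (2 + s) = d by omega, show 2 + s + d - 1 = 1 + s + d by omega]
  nlinarith

theorem num_I1 {q k t : ℕ} (hq : 2 ≤ q) (hk : 2 ≤ k) (ht : 1 ≤ t) (htk : t ≤ k) :
    0 ≤ (q:ℝ) ^ (2*k-1) * ((q:ℝ) ^ (k*(k-1)) + (q:ℝ) ^ (k*(k-t)) * mu q t) ∧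
    ((q:ℝ) ^ (k*(k-1)) + (q:ℝ) ^ (2*k-1) * (cc q k t * mu q t / (q:ℝ) ^ (k - t))) * (q:ℝ) ^ k
      ≤ (q:ℝ) ^ (2*k-1) * ((q:ℝ) ^ (k*(k-1)) + (q:ℝ) ^ (k*(k-t)) * mu q t) := by
  have hq1 : (1:ℝ) ≤ q := by exact_mod_cast (by omega : 1 ≤ q)
  have hq2 : (2:ℝ) ≤ q := by exact_mod_cast hq
  have hq0 : (0:ℝ) < q := by linarith
  rcases Nat.eq_or_lt_of_le ht with rfl | ht2
  · have h1 : mu q 1 = -1 := by simp [mu]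
    rw [h1, cc, if_pos (by omega)]
    have h2 : (q:ℝ) ^ (2*k-1) * ((q:ℝ) ^ (k * (k - (1+1))) * (-1) / (q:ℝ) ^ (k-1)) = - (q:ℝ) ^ (k*(k-1)) := by
      rw [mul_div_assoc', div_eq_iff (by positivity)]
      have : (q:ℝ) ^ (2*k-1) * (q:ℝ) ^ (k * (k - (1+1))) = (q:ℝ) ^ (k*(k-1)) * (q:ℝ) ^ (k-1) := by
        rw [← pow_add, ← pow_add]
        congr 1
        obtain ⟨d, rfl⟩ := Nat.exists_eq_add_of_le hk
        rw [show 2 + d - (1+1) = d by omega, show 2 + d - 1 = d + 1 by omega, show 2 * (2+d) - 1 = 2*d+3 by omega]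
        ring
      linarith
    rw [h2]
    simp
  · set Y := (q:ℝ) ^ (k*(k-1)) with hY
    set x := (q:ℝ) ^ (k*(k-t)) * (q:ℝ)^(t.choose 2) with hx
    have hx0 : 0 < x := by positivity
    have hY0 : 0 < Y := by positivity
    have hxY : q * x ≤ Y := by
      rw [hx, ← pow_add, mul_comm, ← pow_succ]
      exact pow_le_pow_right₀ hq1 (num_choose hk ht2 htk)
    have hxY' : x ≤ Y := by nlinarith
    have hk1 : (q:ℝ)^k ≤ (q:ℝ)^(2*k-1) := pow_le_pow_right₀ hq1 (by omega)
    have hk2 : (q:ℝ)^k * q ≤ (q:ℝ)^(2*k-1) := by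
      rw [← pow_succ]; exact pow_le_pow_right₀ hq1 (by omega)
    have hW : 0 < (q:ℝ)^(2*k-1) := by positivity
    have hk0 : 0 < (q:ℝ)^k := by positivity
    have hcc : 0 ≤ cc q k t := by unfold cc; split_ifs <;> positivity
    rcases Nat.even_or_odd t with he | ho
    · have hmu : mu q t = (q:ℝ)^(t.choose 2) := by simp [mu, he.neg_one_pow]
      rw [hmu, ← hx]
      refine ⟨by positivity, ?_⟩
      have hs : cc q k t * (q:ℝ)^(t.choose 2) / (q:ℝ)^(k-t) * (q:ℝ)^k ≤ x := by
        unfold cc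
        split_ifs with hlt
        · have h3 : (q:ℝ) ^ (k * (k - (t+1))) * (q:ℝ)^k = (q:ℝ)^(k*(k-t)) := by
            rw [← pow_add]; congr 1
            obtain ⟨d, rfl⟩ := Nat.exists_eq_add_of_lt hlt
            rw [show t + d + 1 - (t+1) = d by omega, show t+d+1-t = d+1 by omega]
            ring
          rw [div_mul_eq_mul_div, div_le_iff₀ (by positivity)]
          calc _ = x * 1 := by rw [hx, ← h3]; ring
            _ ≤ _ := by
              apply mul_le_mul_of_nonneg_left _ hx0.le
              exact one_le_pow₀ hq1
        · simp [hx0.le]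
      nlinarith
    · have hmu : mu q t = -(q:ℝ)^(t.choose 2) := by simp [mu, ho.neg_one_pow]
      have h4 : Y + (q:ℝ) ^ (k*(k-t)) * mu q t = Y - x := by rw [hmu, hx]; ring
      rw [h4]
      refine ⟨mul_nonneg hW.le (by linarith), ?_⟩
      have h5 : (q:ℝ) ^ (2*k-1) * (cc q k t * mu q t / (q:ℝ) ^ (k - t)) ≤ 0 := by
        rw [hmu, mul_neg, neg_div, mul_neg, neg_nonpos]
        positivity
      have h6 : Y ≤ q * (Y - x) := by nlinarith
      calc _ ≤ Y * (q:ℝ)^k := by nlinarith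
        _ ≤ q * (Y - x) * (q:ℝ)^k := by nlinarith
        _ = ((q:ℝ)^k * q) * (Y-x) := by ring
        _ ≤ _ := by
          apply mul_le_mul_of_nonneg_right hk2; linarith

section ione
variable {K : Type*} [Field K] [Finite K] {E : Type*} [AddCommGroup E] [Module K E] [Finite E]
set_option linter.unusedSectionVars false
open Classical

theorem eM_nonneg (L : Submodule K E) (k : ℕ) (v : {A // isU L k A} → ℝ) :
    0 ≤ v ⬝ᵥ (eM L k *ᵥ v) := by
  have : v ⬝ᵥ (eM L k *ᵥ v) = ∑ S : Submodule K E, (∑ A : {A // isU L k A}, if A.1 ⊔ L = S then v A else 0) ^ 2 := by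
    simp only [sq, Finset.sum_mul_sum]
    rw [Finset.sum_comm]
    simp only [dotProduct, mulVec, Finset.mul_sum]
    apply Finset.sum_congr rfl
    intro A _
    rw [Finset.sum_comm]
    apply Finset.sum_congr rfl
    intro B _
    rw [Finset.sum_eq_single (A.1 ⊔ L)]
    · simp only [eM, eq_comm]
      by_cases h : A.1 ⊔ L = B.1 ⊔ L <;> simp [h]
    · intro S _ hS
      simp [hS.symm]
    · simp
  rw [this]
  positivity

theorem eM_le {k : ℕ} {L : Submodule K E} (hL : finrank K L = 1) (v : {A // isU L k A} → ℝ) :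
    v ⬝ᵥ (eM L k *ᵥ v) ≤ (Nat.card K : ℝ) ^ k * (v ⬝ᵥ v) := by
  have hrow : ∀ A : {A // isU L k A}, ∑ B, eM L k A B = (Nat.card K : ℝ) ^ k := by
    intro A
    have := eM_chi hL ⊥ (by simp) A
    rw [chi_bot] at this
    simpa [mulVec, dotProduct] using this
  have hcol : ∀ B : {A // isU L k A}, ∑ A, eM L k A B = (Nat.card K : ℝ) ^ k := by
    intro B
    rw [← hrow B]
    apply Finset.sum_congr rfl
    intro A _
    exact (eM_symm L k).apply B A
  have h1 : ∑ A, ∑ B, eM L k A B * (v A ^ 2) = (Nat.card K : ℝ) ^ k * (v ⬝ᵥ v) := by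
    simp only [← Finset.sum_mul, hrow, dotProduct, Finset.mul_sum, sq]
  have h2 : ∑ A, ∑ B, eM L k A B * (v B ^ 2) = (Nat.card K : ℝ) ^ k * (v ⬝ᵥ v) := by
    rw [Finset.sum_comm]
    simp only [← Finset.sum_mul, hcol, dotProduct, Finset.mul_sum, sq]
  have h3 : 2 * (v ⬝ᵥ (eM L k *ᵥ v)) ≤ ∑ A, ∑ B, eM L k A B * (v A ^ 2) + ∑ A, ∑ B, eM L k A B * (v B ^ 2) := by
    simp only [dotProduct, mulVec, Finset.mul_sum, ← Finset.sum_add_distrib]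
    apply Finset.sum_le_sum
    intro A _
    apply Finset.sum_le_sum
    intro B _
    have : 0 ≤ eM L k A B := by unfold eM; split_ifs <;> norm_num
    nlinarith [mul_nonneg this (sq_nonneg (v A - v B))]
  linarith

/-- all ones matrix -/
def jM (ι : Type*) : Matrix ι ι ℝ := fun _ _ => 1

theorem jM_mulVec {ι : Type*} [Fintype ι] (v : ι → ℝ) : jM ι *ᵥ v = (1 ⬝ᵥ v) • (1 : ι → ℝ) := by
  ext i; simp [jM, mulVec, dotProduct]

theorem jM_symm (ι : Type*) : (jM ι).IsSymm := by
  ext i j; rfl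

/-- The PSD matrix. -/
noncomputable def qM (L : Submodule K E) (k : ℕ) (κ : ℝ) : Matrix {A // isU L k A} {A // isU L k A} ℝ :=
  ((Nat.card K : ℝ) ^ (2*k-1) * (Nat.card K : ℝ)^(k*(k-1))) • 1 + ((Nat.card K : ℝ) ^ (2*k-1)) • kn (isU L k)
   - (Nat.card K : ℝ)^(k*(k-1)) • eM L k - κ • jM _

theorem qM_mulVec (L : Submodule K E) (k : ℕ) (κ : ℝ) (v : {A // isU L k A} → ℝ) :
    qM L k κ *ᵥ v = ((Nat.card K : ℝ) ^ (2*k-1) * (Nat.card K : ℝ)^(k*(k-1))) • v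
      + ((Nat.card K : ℝ) ^ (2*k-1)) • (kn (isU L k) *ᵥ v)
      - (Nat.card K : ℝ)^(k*(k-1)) • (eM L k *ᵥ v) - (κ * (1 ⬝ᵥ v)) • 1 := by
  rw [qM, sub_mulVec, sub_mulVec, add_mulVec, smul_mulVec, smul_mulVec, smul_mulVec, smul_mulVec,
    one_mulVec, jM_mulVec, smul_smul]

theorem knU_mem {k : ℕ} (hE : finrank K E = 2 * k) {L : Submodule K E} (hL : finrank K L = 1)
    (T : Submodule K E) : kn (isU L k) *ᵥ chi (isU L k) T ∈ lvl (isU L k) (finrank K T + 1) := by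
  have h1 := lvl_mono _ (Nat.le_succ _) (knU_layer hE hL T)
  have h2 := eM_mem (k := k) hL T
  have h3 := chi_mem (isU L k) (Nat.lt_succ_self (finrank K T))
  have h4 := Submodule.add_mem _ (Submodule.sub_mem _ h1 (Submodule.smul_mem _ (cc (Nat.card K) k (finrank K T) * mu (Nat.card K) (finrank K T) / (Nat.card K : ℝ) ^ (k - finrank K T)) h2))
    (Submodule.smul_mem _ ((Nat.card K : ℝ) ^ (k * (k - finrank K T)) * mu (Nat.card K) (finrank K T)) h3)
  convert h4 using 1
  module

theorem qM_inv {k : ℕ} (hE : finrank K E = 2 * k) {L : Submodule K E} (hL : finrank K L = 1) (κ : ℝ)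
    (t : ℕ) : ∀ v ∈ lvl (isU L k) t, qM L k κ *ᵥ v ∈ lvl (isU L k) t := by
  apply lvl_map
  intro T hT
  rw [qM_mulVec, ← chi_bot (isU L k)]
  refine Submodule.sub_mem _ (Submodule.sub_mem _ (Submodule.add_mem _ ?_ ?_) ?_) ?_
  · exact Submodule.smul_mem _ _ (chi_mem _ hT)
  · exact Submodule.smul_mem _ _ (lvl_mono _ hT (knU_mem hE hL T))
  · exact Submodule.smul_mem _ _ (lvl_mono _ hT (eM_mem hL T))
  · exact Submodule.smul_mem _ _ (chi_mem _ (by rw [finrank_bot]; omega))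

theorem qM_one {k : ℕ} (hk : 2 ≤ k) (hE : finrank K E = 2 * k) {L : Submodule K E} (hL : finrank K L = 1) (κ : ℝ)
    (hκ : κ * gaussBinom (Nat.card K) (2*k-1) (k-1) = (Nat.card K : ℝ)^(k*(k-1)) * ((Nat.card K : ℝ)^(2*k-1) - 1)) :
    qM L k κ *ᵥ 1 = 0 := by
  have hq0 : (Nat.card K : ℝ) ≠ 0 := by exact_mod_cast (Nat.card_pos (α := K)).ne'
  have hE1 : eM L k *ᵥ 1 = (Nat.card K : ℝ)^k • (1 : {A // isU L k A} → ℝ) := by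
    ext A
    have := eM_chi hL ⊥ (by simp) A
    rw [chi_bot] at this
    simpa using this
  have h1 := knU_layer (k := k) hE hL ⊥
  rw [chi_bot, finrank_bot, lvl_zero, Submodule.mem_bot, hE1, smul_smul, cc, if_pos (by omega)] at h1
  have hmu : mu (Nat.card K) 0 = 1 := by simp [mu]
  rw [hmu] at h1
  have h2 : kn (isU L k) *ᵥ 1 = ((Nat.card K : ℝ)^(k*k) - (Nat.card K : ℝ)^(k*(k-1))) • (1 : {A // isU L k A} → ℝ) := by
    rw [sub_smul]
    simp only [tsub_zero, zero_add, mul_one] at h1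
    rw [div_mul_cancel₀ _ (pow_ne_zero _ hq0)] at h1
    rw [← sub_eq_zero, ← h1]
    module
  have h3 : (1 : {A // isU L k A} → ℝ) ⬝ᵥ 1 = (Nat.card K : ℝ)^k * gaussBinom (Nat.card K) (2*k-1) (k-1) := by
    have := card_U (by omega) hE hL
    simp only [dotProduct, Pi.one_apply, mul_one, Finset.sum_const, Finset.card_univ, nsmul_eq_mul]
    rw [this]; push_cast; ring
  rw [qM_mulVec, h2, hE1, h3]
  have h4 : (Nat.card K : ℝ)^(k*k) = (Nat.card K : ℝ)^(k*(k-1)) * (Nat.card K : ℝ)^k := by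
    rw [← pow_add]; congr 1
    obtain ⟨d, rfl⟩ := Nat.exists_eq_add_of_le hk
    rw [show 2 + d - 1 = d + 1 by omega]; ring
  rw [smul_smul, smul_smul, ← add_smul, ← sub_smul, ← sub_smul, h4]
  convert zero_smul ℝ _
  linear_combination (-(Nat.card K : ℝ)^k) * hκ

theorem qM_form {k : ℕ} (hE : finrank K E = 2 * k) {L : Submodule K E} (hL : finrank K L = 1) (κ : ℝ)
    (t : ℕ) (ht : 1 ≤ t) (v : {A // isU L k A} → ℝ) (hv : v ∈ lvl (isU L k) (t+1))
    (ho : ∀ w ∈ lvl (isU L k) t, w ⬝ᵥ v = 0) :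
    v ⬝ᵥ (qM L k κ *ᵥ v) = 
      ((Nat.card K:ℝ) ^ (2*k-1) * ((Nat.card K:ℝ) ^ (k*(k-1)) + (Nat.card K:ℝ) ^ (k*(k-t)) * mu (Nat.card K) t)) * (v ⬝ᵥ v)
      - ((Nat.card K:ℝ) ^ (k*(k-1)) + (Nat.card K:ℝ) ^ (2*k-1) * (cc (Nat.card K) k t * mu (Nat.card K) t / (Nat.card K:ℝ) ^ (k - t)))
        * (v ⬝ᵥ (eM L k *ᵥ v)) := by
  have h := form_layer (isU L k) (kn (isU L k) - ((Nat.card K : ℝ) ^ (k * (k - t)) * mu (Nat.card K) t) • 1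
      + (cc (Nat.card K) k t * mu (Nat.card K) t / (Nat.card K : ℝ) ^ (k - t)) • eM L k) t
    (by
      intro T hT
      rw [add_mulVec, sub_mulVec, smul_mulVec, one_mulVec, smul_mulVec]
      rcases Nat.lt_succ_iff_lt_or_eq.1 hT with h | rfl
      · refine Submodule.add_mem _ (Submodule.sub_mem _ ?_ ?_) ?_
        · exact lvl_mono _ h (knU_mem hE hL T)
        · exact Submodule.smul_mem _ _ (chi_mem _ h)
        · exact Submodule.smul_mem _ _ (lvl_mono _ h (eM_mem hL T))
      · exact knU_layer hE hL T) v hv ho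
  have h1 : (1 : {A // isU L k A} → ℝ) ⬝ᵥ v = 0 := by
    rw [← chi_bot]; exact ho _ (chi_mem _ (by rw [finrank_bot]; omega))
  rw [add_mulVec, sub_mulVec, smul_mulVec, one_mulVec, smul_mulVec, dotProduct_add, dotProduct_sub,
    dotProduct_smul, dotProduct_smul, smul_eq_mul, smul_eq_mul] at h
  rw [qM_mulVec, h1, mul_zero, zero_smul, sub_zero, dotProduct_sub, dotProduct_add, dotProduct_smul,
    dotProduct_smul, dotProduct_smul, smul_eq_mul, smul_eq_mul, smul_eq_mul]
  linear_combination ((Nat.card K:ℝ) ^ (2*k-1)) * h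

theorem qM_psd {k : ℕ} (hk : 2 ≤ k) (hE : finrank K E = 2 * k) {L : Submodule K E} (hL : finrank K L = 1) (κ : ℝ)
    (hκ : κ * gaussBinom (Nat.card K) (2*k-1) (k-1) = (Nat.card K : ℝ)^(k*(k-1)) * ((Nat.card K : ℝ)^(2*k-1) - 1))
    (v : {A // isU L k A} → ℝ) : 0 ≤ v ⬝ᵥ (qM L k κ *ᵥ v) := by
  have hq : 2 ≤ Nat.card K := Finite.one_lt_card
  have hsymm : (qM L k κ).IsSymm := by
    unfold qM
    exact ((((isSymm_one).smul _).add ((kn_symm _).smul _)).sub ((eM_symm L k).smul _)).sub ((jM_symm _).smul _)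
  refine psd_filtration _ hsymm (lvl (isU L k)) (lvl_mono _) 0 (k+1) (qM_inv hE hL κ) ?_ (k+1) (Nat.zero_le _) le_rfl
    v (lvl_top _ (fun A hA => hA.1) v) ?_
  · intro t _ htk w hw ho
    rcases Nat.eq_zero_or_pos t with rfl | ht
    · have : qM L k κ *ᵥ w = 0 := by
        have := lvl_map (isU L k) (qM L k κ) ⊥ 1 (by
          intro T hT
          have : T = ⊥ := by
            have : Module.Finite K E := Module.Finite.of_finite
            exact Submodule.finrank_eq_zero.1 (by omega)
          rw [this, chi_bot, qM_one hk hE hL κ hκ]; exact Submodule.zero_mem _) w hw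
        simpa using this
      rw [this]; simp
    · rw [qM_form hE hL κ t ht w hw ho]
      obtain ⟨h1, h2⟩ := num_I1 hq hk ht (by omega)
      have h3 := eM_nonneg L k w
      have h4 := eM_le hL w
      have h5 : 0 ≤ w ⬝ᵥ w := by
        rw [dotProduct]; exact Finset.sum_nonneg fun i _ => mul_self_nonneg _
      rw [sub_nonneg]
      rcases le_total 0 ((Nat.card K:ℝ) ^ (k*(k-1)) + (Nat.card K:ℝ) ^ (2*k-1) * (cc (Nat.card K) k t * mu (Nat.card K) t / (Nat.card K:ℝ) ^ (k - t))) with hb | hb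
      · calc _ ≤ _ * ((Nat.card K : ℝ) ^ k * (w ⬝ᵥ w)) := mul_le_mul_of_nonneg_left h4 hb
          _ = (_ * (Nat.card K : ℝ) ^ k) * (w ⬝ᵥ w) := by ring
          _ ≤ _ := mul_le_mul_of_nonneg_right h2 h5
      · calc _ ≤ 0 := mul_nonpos_of_nonpos_of_nonneg hb h3
          _ ≤ _ := mul_nonneg h1 h5
  · intro w hw
    rw [lvl_zero, Submodule.mem_bot] at hw
    simp [hw]

theorem gauss_pos {k : ℕ} (hk : 1 ≤ k) (hE : finrank K E = 2 * k) : 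
    0 < gaussBinom (Nat.card K) (2*k-1) (k-1) := by
  have : Module.Finite K E := Module.Finite.of_finite
  obtain ⟨f, hf⟩ := exists_linearIndependent_of_le_finrank (R := K) (M := E) (n := k) (by omega)
  have hA := finrank_span_eq_card hf
  rw [Fintype.card_fin] at hA
  obtain ⟨p, hpA, hp⟩ := exists_point (C := Submodule.span K (Set.range f)) (by
    intro h
    rw [h, finrank_bot] at hA
    omega)
  have h := cnt_ge p k (by omega)
  rw [hp, hE] at h
  rw [← h]
  exact Finset.card_pos.2 ⟨_, Finset.mem_filter.2 ⟨Finset.mem_univ _, hA, hpA⟩⟩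

theorem I1 {k : ℕ} (hk : 2 ≤ k) (hE : finrank K E = 2 * k) {L : Submodule K E} (hL : finrank K L = 1)
    (𝒞 : Finset (Submodule K E)) (h𝒞 : ∀ C ∈ 𝒞, finrank K C = k ∧ L ⊓ C = ⊥)
    (hint : ∀ C ∈ 𝒞, ∀ C' ∈ 𝒞, C ⊓ C' ≠ ⊥) :
    (gaussBinom (Nat.card K) (2*k-1) (k-1) : ℝ) * ∑ C ∈ 𝒞, ∑ C' ∈ 𝒞, (if C ⊔ L = C' ⊔ L then (1:ℝ) else 0)
      + ((Nat.card K : ℝ)^(2*k-1) - 1) * (𝒞.card : ℝ)^2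
     ≤ (gaussBinom (Nat.card K) (2*k-1) (k-1) : ℝ) * (Nat.card K : ℝ)^(2*k-1) * 𝒞.card := by
  set G : ℝ := (gaussBinom (Nat.card K) (2*k-1) (k-1) : ℝ) with hG
  have hG0 : 0 < G := by
    rw [hG]; exact_mod_cast gauss_pos (K := K) (E := E) (by omega) hE
  have hq : 0 < (Nat.card K : ℝ) := by exact_mod_cast Nat.card_pos
  set κ : ℝ := (Nat.card K : ℝ)^(k*(k-1)) * ((Nat.card K : ℝ)^(2*k-1) - 1) / G with hκ
  have hκ' : κ * G = (Nat.card K : ℝ)^(k*(k-1)) * ((Nat.card K : ℝ)^(2*k-1) - 1) := by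
    rw [hκ, div_mul_cancel₀ _ hG0.ne']
  have hsubU : ∀ C ∈ 𝒞, isU L k C := by
    intro C hC
    refine ⟨(h𝒞 C hC).1, fun h => ?_⟩
    have := (h𝒞 C hC).2
    rw [inf_eq_left.2 h] at this
    rw [this, finrank_bot] at hL; omega
  let f : {A // isU L k A} → ℝ := fun A => if A.1 ∈ 𝒞 then 1 else 0
  have hsum : ∀ g : Submodule K E → ℝ, ∑ A : {A // isU L k A}, f A * g A.1 = ∑ C ∈ 𝒞, g C := by
    intro g
    have := sum_sub (isU L k) (fun A => (if A ∈ 𝒞 then 1 else 0) * g A)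
    simp only [f]
    rw [this]
    simp only [ite_mul, one_mul, zero_mul]
    rw [← Finset.sum_filter, Finset.filter_filter]
    apply Finset.sum_congr _ (fun _ _ => rfl)
    ext C
    rw [Finset.mem_filter]
    constructor
    · intro h; exact h.2.2
    · intro h; exact ⟨Finset.mem_univ _, hsubU C h, h⟩
  have hQ := qM_psd hk hE hL κ hκ' f
  have hform : ∀ m : Submodule K E → Submodule K E → ℝ,
      f ⬝ᵥ ((fun A B => m A.1 B.1 : Matrix {A // isU L k A} {A // isU L k A} ℝ) *ᵥ f) = ∑ C ∈ 𝒞, ∑ C' ∈ 𝒞, m C C' := by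
    intro m
    simp only [dotProduct, mulVec]
    rw [← hsum]
    apply Finset.sum_congr rfl
    intro A _
    rw [← hsum]
    congr 1
    apply Finset.sum_congr rfl
    intro B _
    ring
  have h1 : f ⬝ᵥ (kn (isU L k) *ᵥ f) = 0 := by
    have := hform (fun A B => if A ⊓ B = ⊥ then 1 else 0)
    refine Eq.trans this ?_
    apply Finset.sum_eq_zero; intro C hC
    apply Finset.sum_eq_zero; intro C' hC'
    rw [if_neg (hint C hC C' hC')]
  have h2 : f ⬝ᵥ (eM L k *ᵥ f) = ∑ C ∈ 𝒞, ∑ C' ∈ 𝒞, (if C ⊔ L = C' ⊔ L then (1:ℝ) else 0) :=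
    hform (fun A B => if A ⊔ L = B ⊔ L then 1 else 0)
  have h3 : f ⬝ᵥ f = 𝒞.card := by
    have := hsum (fun A => if A ∈ 𝒞 then 1 else 0)
    refine Eq.trans this ?_
    simp
  have h4 : (1 : {A // isU L k A} → ℝ) ⬝ᵥ f = 𝒞.card := by
    have := hsum (fun A => 1)
    rw [dotProduct_comm]
    refine Eq.trans this ?_
    simp
  rw [qM_mulVec, dotProduct_sub, dotProduct_sub, dotProduct_add, dotProduct_smul, dotProduct_smul,
    dotProduct_smul, dotProduct_smul, h1, h2, h3, dotProduct_comm f 1, h4] at hQ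
  simp only [smul_eq_mul, mul_zero, add_zero] at hQ
  set S := ∑ C ∈ 𝒞, ∑ C' ∈ 𝒞, (if C ⊔ L = C' ⊔ L then (1:ℝ) else 0)
  have hY : 0 < (Nat.card K : ℝ)^(k*(k-1)) := by positivity
  rw [← mul_le_mul_iff_right₀ hY]
  have h5 := mul_nonneg hG0.le hQ
  have h6 : G * (κ * (𝒞.card : ℝ) * 𝒞.card) = (Nat.card K : ℝ)^(k*(k-1)) * ((Nat.card K : ℝ)^(2*k-1) - 1) * (𝒞.card : ℝ)^2 := by
    rw [← hκ']; ring
  nlinarith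

end ione
end EKR

namespace EKR
open Module Matrix

section absineq
open Classical

theorem abs_col {ι : Type*} (s : Finset ι) (g y : ι → ℝ) (κ W : ℝ) (hκ : 0 ≤ κ) (hW : W = 1 + κ * s.card) :
    2 * ∑ A ∈ s, y A * g A - ∑ A ∈ s, y A ^ 2 + κ / W * (∑ A ∈ s, y A) ^ 2
      ≤ ∑ A ∈ s, g A ^ 2 + κ * (∑ A ∈ s, g A) ^ 2 := by
  have hW0 : 0 < W := by rw [hW]; positivity
  set Y := ∑ A ∈ s, y A with hY
  set F := ∑ A ∈ s, g A with hF
  set z := Y / W with hz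
  have hzW : z * W = Y := by rw [hz, div_mul_cancel₀ _ hW0.ne']
  have h1 : 0 ≤ ∑ A ∈ s, (g A - y A + κ * z) ^ 2 := Finset.sum_nonneg fun _ _ => sq_nonneg _
  have h2 : ∑ A ∈ s, (g A - y A + κ * z) ^ 2 = ∑ A ∈ s, g A ^ 2 + ∑ A ∈ s, y A ^ 2 + s.card * (κ * z)^2
     - 2 * ∑ A ∈ s, y A * g A + 2 * κ * z * F - 2 * κ * z * Y := by
    have : ∀ A, (g A - y A + κ * z) ^ 2 = g A ^ 2 + y A ^ 2 + (κ * z)^2 - 2 * (y A * g A) + 2 * κ * z * g A - 2 * κ * z * y A := by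
      intro A; ring
    simp only [this, Finset.sum_add_distrib, Finset.sum_sub_distrib, Finset.sum_const, nsmul_eq_mul, ← Finset.mul_sum]
    rfl
  have h3 : 0 ≤ κ * (F - z) ^ 2 := by positivity
  have h4 : κ / W * Y ^ 2 = κ * z * Y := by
    rw [hz]; ring
  rw [h4]
  have h5 : κ * z * (z * W) = κ * z * Y := by rw [hzW]
  rw [hW] at h5
  nlinarith

theorem abs_sum {ι ι' : Type*} [Fintype ι] [Fintype ι'] (I : ι → ι' → Prop) (g : ι → ι' → ℝ)
    (hs : ∀ A H, g A H ≠ 0 → I A H) (a m : ℕ) (ha : ∀ A, (Finset.univ.filter fun H => I A H).card = a)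
    (hm : ∀ H, (Finset.univ.filter fun A => I A H).card = m) (κ W : ℝ) (hκ : 0 ≤ κ) (hW : W = 1 + κ * m)
    (y : ι → ℝ) :
    2 * ∑ A, y A * ∑ H, g A H - a * ∑ A, y A ^ 2 + κ / W * ∑ H, (∑ A ∈ Finset.univ.filter (fun A => I A H), y A) ^ 2
      ≤ ∑ A, ∑ H, g A H ^ 2 + κ * ∑ H, (∑ A, g A H) ^ 2 := by
  have hg : ∀ H, ∀ e : ι → ℝ, (∀ A, g A H = 0 → e A = 0) → ∑ A, e A = ∑ A ∈ Finset.univ.filter (fun A => I A H), e A := by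
    intro H e he
    symm
    apply Finset.sum_subset (Finset.subset_univ _)
    intro A _ hA
    apply he
    by_contra h
    exact hA (by simp [hs A H h])
  have h1 := Finset.sum_le_sum fun H (_ : H ∈ Finset.univ) =>
    abs_col (Finset.univ.filter (fun A => I A H)) (fun A => g A H) y κ W hκ (by rw [hm, hW])
  have e1 : ∑ A, y A * ∑ H, g A H = ∑ H, ∑ A ∈ Finset.univ.filter (fun A => I A H), y A * g A H := by
    simp only [Finset.mul_sum]
    rw [Finset.sum_comm]
    exact Finset.sum_congr rfl fun H _ => hg H _ (by intro A h; simp [h])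
  have e2 : ∑ A, ∑ H, g A H ^ 2 = ∑ H, ∑ A ∈ Finset.univ.filter (fun A => I A H), g A H ^ 2 := by
    rw [Finset.sum_comm]
    exact Finset.sum_congr rfl fun H _ => hg H _ (by intro A h; simp [h])
  have e3 : ∑ H, (∑ A, g A H) ^ 2 = ∑ H, (∑ A ∈ Finset.univ.filter (fun A => I A H), g A H) ^ 2 := by
    refine Finset.sum_congr rfl fun H _ => ?_
    rw [hg H (fun A => g A H) (by intro A h; simp [h])]
  have e4 : (a:ℝ) * ∑ A, y A ^ 2 = ∑ H, ∑ A ∈ Finset.univ.filter (fun A => I A H), y A ^ 2 := by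
    simp only [Finset.sum_filter]
    rw [Finset.sum_comm, Finset.mul_sum]
    refine Finset.sum_congr rfl fun A _ => ?_
    rw [← Finset.sum_filter, Finset.sum_const, ha, nsmul_eq_mul]
  rw [e1, e2, e3, e4]
  simp only [Finset.sum_add_distrib, Finset.sum_sub_distrib, ← Finset.mul_sum] at h1
  exact h1

end absineq

theorem final_num (Q a w qk D M N S n0 n1 n2 : ℝ) (hQ : 2 ≤ Q) (ha : 1 + Q ≤ a)
    (hqk : (Q - 1) * a = qk - 1) (hw : w * Q = qk ^ 2) (hD : D = qk * (a - 1) + 1)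
    (hM : 0 < M) (hN : N = (qk + 1) * M)
    (hS : 0 ≤ S) (h2 : 0 ≤ n2) (hn0 : n0 * N = S ^ 2) (hkn : qk * n0 ≤ n1 + n2 / Q)
    (hLB : w / a * n0 + qk / D * n1 + n2 / a ≤ w * S) : S ≤ M * D := by
  have ha0 : 0 < a := by linarith
  have hqk0 : 1 < qk := by nlinarith
  have hw0 : 0 < w := by
    by_contra h
    nlinarith [sq_nonneg qk, mul_pos (by linarith : 0 < qk) (by linarith : 0 < qk)]
  have hD0 : 0 < D := by nlinarith
  have hDa : D + Q * a = a * (qk + 1) := by rw [hD]; linarith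
  have hDq : qk * a ≤ Q * D := by
    rw [hD]
    nlinarith [mul_nonneg (by linarith : 0 ≤ qk) (by nlinarith : 0 ≤ (Q - 1) * a - Q)]
  have h3 : qk / D * (qk * n0) ≤ qk / D * (n1 + n2 / Q) :=
    mul_le_mul_of_nonneg_left hkn (by positivity)
  have h4 : qk / D * (n2 / Q) ≤ n2 / a := by
    rw [div_mul_div_comm, div_le_div_iff₀ (by positivity) ha0]
    nlinarith
  have h5 : w / a * n0 + qk / D * (qk * n0) ≤ w * S := by
    have : qk / D * (n1 + n2 / Q) = qk / D * n1 + qk / D * (n2 / Q) := by ring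
    linarith
  have h6 : w / a * n0 + qk / D * (qk * n0) = w * (qk + 1) * n0 / D := by
    field_simp
    have e : n0 * (D * w + qk ^ 2 * a) = n0 * (w * (a * (qk+1))) := by rw [← hw, ← hDa]; ring
    linarith
  rw [h6, div_le_iff₀ hD0] at h5
  have h7 : (qk + 1) * n0 ≤ S * D := by
    have : w * ((qk+1) * n0) ≤ w * (S * D) := by linarith
    exact le_of_mul_le_mul_left this hw0
  have h8 : S ^ 2 ≤ S * (M * D) := by
    rw [← hn0, hN]
    nlinarith
  by_contra hc
  push Not at hc
  have : 0 < M * D := by positivity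
  nlinarith

section ithree
variable {K : Type*} [Field K] [Finite K] {E : Type*} [AddCommGroup E] [Module K E] [Finite E]
set_option linter.unusedSectionVars false
open Classical

/-- the set of points -/
noncomputable def pts (K : Type*) [Field K] [Finite K] (E : Type*) [AddCommGroup E] [Module K E] [Finite E] :
    Finset (Submodule K E) := Finset.univ.filter fun p => finrank K p = 1

/-- Matrix counting common points. -/
noncomputable def cM (K : Type*) [Field K] [Finite K] (E : Type*) [AddCommGroup E] [Module K E] [Finite E] (k : ℕ) :
    Matrix {A : Submodule K E // isK K k A} {A : Submodule K E // isK K k A} ℝ :=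
  fun A B => ∑ p ∈ pts K E, chi (isK K k) p A * chi (isK K k) p B

theorem cM_mulVec (k : ℕ) (y : {A : Submodule K E // isK K k A} → ℝ) :
    cM K E k *ᵥ y = ∑ p ∈ pts K E, (chi (isK K k) p ⬝ᵥ y) • chi (isK K k) p := by
  ext A
  simp only [mulVec, dotProduct, cM, Finset.sum_apply, Pi.smul_apply, smul_eq_mul, Finset.sum_mul]
  rw [Finset.sum_comm]
  refine Finset.sum_congr rfl fun p _ => Finset.sum_congr rfl fun B _ => ?_
  ring

theorem cM_symm (k : ℕ) : (cM K E k).IsSymm := by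
  ext A B
  simp only [transpose_apply, cM, mul_comm]

theorem cM_orth (k : ℕ) (y : {A : Submodule K E // isK K k A} → ℝ)
    (h : ∀ w ∈ lvl (isK K k) 2, w ⬝ᵥ y = 0) : cM K E k *ᵥ y = 0 := by
  rw [cM_mulVec]
  apply Finset.sum_eq_zero
  intro p hp
  simp only [pts, Finset.mem_filter] at hp
  rw [h _ (chi_mem _ (by omega)), zero_smul]

theorem cM_apply (k : ℕ) (A B : {A : Submodule K E // isK K k A}) :
    cM K E k A B = gI (Nat.card K) (finrank K (A.1 ⊓ B.1 : Submodule K E)) := by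
  rw [← cnt_points]
  simp only [cM, chi, bool_mul]
  rw [Finset.sum_boole, pts, Finset.filter_filter]
  congr 2
  ext p
  simp only [Finset.mem_filter, Finset.mem_univ, true_and, le_inf_iff]
  tauto

theorem chi_dot (k : ℕ) (p T : Submodule K E) : chi (isK K k) p ⬝ᵥ chi (isK K k) T
    = ((Finset.univ.filter fun A : Submodule K E => finrank K A = k ∧ p ⊔ T ≤ A).card : ℝ) := by
  simp only [dotProduct, chi, bool_mul]
  rw [sum_bool_sub (isK K k) (fun A => T ≤ A ∧ p ≤ A)]
  congr 2
  ext A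
  rw [Finset.mem_filter, Finset.mem_filter]
  simp only [isK, sup_le_iff]
  tauto

theorem sum_chi_pts (k : ℕ) (A : {A : Submodule K E // isK K k A}) :
    ∑ p ∈ pts K E, chi (isK K k) p A = gI (Nat.card K) k := by
  simp only [chi]
  have h := cnt_points A.1
  rw [show finrank K A.1 = k from A.2] at h
  rw [← h, Finset.sum_boole, pts, Finset.filter_filter]
  simp only [and_comm]

theorem cM_one {k : ℕ} (hk : 2 ≤ k) (hE : finrank K E = 2 * k) :
    cM K E k *ᵥ 1 = ((gI (Nat.card K) k : ℝ) * gaussBinom (Nat.card K) (2*k-1) (k-1)) • 1 := by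
  rw [cM_mulVec]
  ext A
  rw [Finset.sum_apply, Pi.smul_apply, Pi.one_apply, smul_eq_mul, mul_one, ← sum_chi_pts k A, Finset.sum_mul]
  refine Finset.sum_congr rfl fun p hp => ?_
  simp only [pts, Finset.mem_filter, Finset.mem_univ, true_and] at hp
  rw [← chi_bot, chi_dot, sup_bot_eq, cnt_ge p k (by omega), hp, hE, Pi.smul_apply, smul_eq_mul, mul_comm]

theorem cM_point {k : ℕ} (hk : 2 ≤ k) (hE : finrank K E = 2 * k) (T : Submodule K E) (hT : finrank K T = 1) :
    cM K E k *ᵥ chi (isK K k) T =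
      ((gaussBinom (Nat.card K) (2*k-1) (k-1) : ℝ) - gaussBinom (Nat.card K) (2*k-2) (k-2)) • chi (isK K k) T
       + ((gI (Nat.card K) k : ℝ) * gaussBinom (Nat.card K) (2*k-2) (k-2)) • 1 := by
  rw [cM_mulVec]
  ext A
  have hTp : T ∈ pts K E := by simp [pts, hT]
  rw [Finset.sum_apply, Pi.add_apply, Pi.smul_apply, Pi.smul_apply, Pi.one_apply, smul_eq_mul, smul_eq_mul,
    mul_one, ← sum_chi_pts k A, Finset.sum_mul, ← Finset.add_sum_erase _ _ hTp, ← Finset.add_sum_erase _ _ hTp]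
  have h1 : chi (isK K k) T ⬝ᵥ chi (isK K k) T = gaussBinom (Nat.card K) (2*k-1) (k-1) := by
    rw [chi_dot, sup_idem, cnt_ge T k (by omega), hT, hE]
  rw [Pi.smul_apply, h1, smul_eq_mul]
  have h2 : ∑ p ∈ (pts K E).erase T, ((chi (isK K k) p ⬝ᵥ chi (isK K k) T) • chi (isK K k) p) A
    = ∑ p ∈ (pts K E).erase T, chi (isK K k) p A * (gaussBinom (Nat.card K) (2*k-2) (k-2) : ℝ) := by
    refine Finset.sum_congr rfl fun p hp => ?_
    simp only [pts, Finset.mem_erase, Finset.mem_filter, Finset.mem_univ, true_and] at hp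
    have : Module.Finite K E := Module.Finite.of_finite
    have h3 : ¬ p ≤ T := fun h => hp.1 (Submodule.eq_of_le_of_finrank_eq h (by omega))
    have h4 := finrank_sup_of_inf (point_inf hp.2 h3)
    rw [hp.2, hT] at h4
    rw [chi_dot, cnt_ge _ k (by omega), h4, hE, Pi.smul_apply, smul_eq_mul, mul_comm]
  rw [h2]
  ring

theorem cM_form0 {k : ℕ} (hk : 2 ≤ k) (hE : finrank K E = 2 * k)
    (v : {A : Submodule K E // isK K k A} → ℝ) (hv : v ∈ lvl (isK K k) 1) :
    cM K E k *ᵥ v = ((gI (Nat.card K) k : ℝ) * gaussBinom (Nat.card K) (2*k-1) (k-1)) • v := by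
  have : Module.Finite K E := Module.Finite.of_finite
  have h := lvl_map (isK K k) (cM K E k - ((gI (Nat.card K) k : ℝ) * gaussBinom (Nat.card K) (2*k-1) (k-1)) • 1) ⊥ 1
    (by
      intro T hT
      have : T = ⊥ := Submodule.finrank_eq_zero.1 (by omega)
      rw [this, chi_bot, sub_mulVec, smul_mulVec, one_mulVec, cM_one hk hE, sub_self]
      exact Submodule.zero_mem _) v hv
  rw [Submodule.mem_bot, sub_mulVec, smul_mulVec, one_mulVec, sub_eq_zero] at h
  exact h

theorem cM_form1 {k : ℕ} (hk : 2 ≤ k) (hE : finrank K E = 2 * k)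
    (v : {A : Submodule K E // isK K k A} → ℝ) (hv : v ∈ lvl (isK K k) 2)
    (ho : ∀ w ∈ lvl (isK K k) 1, w ⬝ᵥ v = 0) :
    v ⬝ᵥ (cM K E k *ᵥ v) =
      ((gaussBinom (Nat.card K) (2*k-1) (k-1) : ℝ) - gaussBinom (Nat.card K) (2*k-2) (k-2)) * (v ⬝ᵥ v) := by
  have : Module.Finite K E := Module.Finite.of_finite
  have h := form_layer (isK K k) (cM K E k - ((gaussBinom (Nat.card K) (2*k-1) (k-1) : ℝ) - gaussBinom (Nat.card K) (2*k-2) (k-2)) • 1) 1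
    (by
      intro T hT
      have hone : (1 : {A : Submodule K E // isK K k A} → ℝ) ∈ lvl (isK K k) 1 := by
        rw [← chi_bot]; exact chi_mem _ (by rw [finrank_bot]; omega)
      rw [sub_mulVec, smul_mulVec, one_mulVec]
      rcases Nat.lt_succ_iff_lt_or_eq.1 hT with h | h
      · have : T = ⊥ := Submodule.finrank_eq_zero.1 (by omega)
        rw [this, chi_bot, cM_one hk hE]
        exact Submodule.sub_mem _ (Submodule.smul_mem _ _ hone) (Submodule.smul_mem _ _ hone)
      · rw [cM_point hk hE T h, add_sub_cancel_left]
        exact Submodule.smul_mem _ _ hone) v hv ho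
  rw [sub_mulVec, smul_mulVec, one_mulVec, dotProduct_sub, dotProduct_smul, smul_eq_mul] at h
  linarith

theorem kn_lower {k : ℕ} (hk : 2 ≤ k) (hE : finrank K E = 2 * k)
    (f : {A : Submodule K E // isK K k A} → ℝ) (ho : ∀ w ∈ lvl (isK K k) 2, w ⬝ᵥ f = 0) :
    - ((Nat.card K : ℝ) ^ (k*(k-1)) / Nat.card K) * (f ⬝ᵥ f) ≤ f ⬝ᵥ (kn (isK K k) *ᵥ f) := by
  have hq : 2 ≤ Nat.card K := Finite.one_lt_card
  have hq0 : (0:ℝ) < Nat.card K := by exact_mod_cast (by omega : 0 < Nat.card K)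
  have h := psd_filtration (kn (isK K k) + ((Nat.card K : ℝ) ^ (k*(k-1)) / Nat.card K) • 1)
    ((kn_symm _).add ((isSymm_one).smul _)) (lvl (isK K k)) (lvl_mono _) 2 (k+1)
    (by
      intro t v hv
      rw [add_mulVec, smul_mulVec, one_mulVec]
      exact Submodule.add_mem _ (kn_inv hE t v hv) (Submodule.smul_mem _ _ hv))
    (by
      intro t ht htk v hv ho
      rw [add_mulVec, smul_mulVec, one_mulVec, dotProduct_add, dotProduct_smul, smul_eq_mul,
        kn_form hE t v hv ho, ← add_mul]
      apply mul_nonneg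
      · have h1 : (Nat.card K : ℝ)^(k*(k-t)) * (Nat.card K : ℝ)^(t.choose 2) ≤ (Nat.card K : ℝ) ^ (k*(k-1)) / Nat.card K := by
          rw [le_div_iff₀ hq0, ← pow_add, ← pow_succ]
          exact pow_le_pow_right₀ (by exact_mod_cast (by omega : 1 ≤ Nat.card K)) (num_choose hk ht (by omega))
        have h2 : -(Nat.card K : ℝ)^(t.choose 2) ≤ mu (Nat.card K) t := by
          unfold mu
          have : (0:ℝ) < (Nat.card K : ℝ)^(t.choose 2) := by positivity
          rcases Nat.even_or_odd t with h | h <;> rw [h.neg_one_pow] <;> linarith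
        have h3 : (0:ℝ) < (Nat.card K : ℝ)^(k*(k-t)) := by positivity
        nlinarith
      · rw [dotProduct]; exact Finset.sum_nonneg fun i _ => mul_self_nonneg _)
    (k+1) (by omega) le_rfl f (lvl_top _ (fun A hA => hA) f) ho
  rw [add_mulVec, smul_mulVec, one_mulVec, dotProduct_add, dotProduct_smul, smul_eq_mul] at h
  linarith

theorem cnt_hyp {k : ℕ} (hE : finrank K E = 2 * k) (D : Submodule K E) :
    (Finset.univ.filter fun H : {H : Submodule K E // finrank K H + 1 = 2 * k} => D ≤ H.1).card
      = gI (Nat.card K) (2 * k - finrank K D) := by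
  have h := card_hyp_ge D
  rw [hE, natcard_filter] at h
  rw [← h, ← Finset.card_map (Function.Embedding.subtype _)]
  congr 1
  ext H
  simp only [Finset.mem_map, Finset.mem_filter, Finset.mem_univ, true_and, Function.Embedding.subtype_apply,
    Subtype.exists, exists_and_left, exists_prop]
  constructor
  · rintro ⟨a, b, c, rfl⟩; exact ⟨b, c⟩
  · rintro ⟨b, c⟩; exact ⟨H, b, c, rfl⟩

theorem cnt_le_hyp' {k : ℕ} (H : Submodule K E) (hH : finrank K H + 1 = 2 * k) :
    (Finset.univ.filter fun A : {A : Submodule K E // isK K k A} => A.1 ≤ H).card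
      = gaussBinom (Nat.card K) (2*k-1) k := by
  have h := card_sub_le H k
  rw [card_grass', natcard_filter, show finrank K H = 2*k-1 by omega] at h
  rw [← h, ← Finset.card_map (Function.Embedding.subtype _)]
  congr 1
  ext A
  simp only [Finset.mem_map, Finset.mem_filter, Finset.mem_univ, true_and, Function.Embedding.subtype_apply,
    Subtype.exists, exists_and_left, exists_prop]
  constructor
  · rintro ⟨a, b, c, rfl⟩; exact ⟨b, c⟩
  · rintro ⟨b, c⟩; exact ⟨A, b, c, rfl⟩

theorem cnt_le_hyp {k : ℕ} (hk : 2 ≤ k) (hE : finrank K E = 2 * k) (H : Submodule K E) (hH : finrank K H + 1 = 2 * k) :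
    (Finset.univ.filter fun A : {A : Submodule K E // isK K k A} => A.1 ≤ H).card
      = gaussBinom (Nat.card K) (2*k-1) (k-1) := by
  have hf := flag_count (K := K) (E := E) (k := k) (by omega)
  rw [hE] at hf
  have := Finset.sum_card_bipartiteAbove_eq_sum_card_bipartiteBelow
    (fun (A : {A : Submodule K E // isK K k A}) (H : {H : Submodule K E // finrank K H + 1 = 2 * k}) => A.1 ≤ H.1)
    (s := Finset.univ) (t := Finset.univ)
  rw [Finset.sum_congr rfl (g := fun _ => gI (Nat.card K) k), Finset.sum_const,
    Finset.sum_congr (s₁ := (Finset.univ : Finset {H : Submodule K E // finrank K H + 1 = 2 * k})) rfl (g := fun _ => gaussBinom (Nat.card K) (2*k-1) k),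
    Finset.sum_const] at this
  · rw [cnt_le_hyp' H hH]
    have h1 := cnt_hyp hE (⊥ : Submodule K E)
    simp only [bot_le, Finset.filter_true, finrank_bot, Nat.sub_zero] at h1
    have h2 : (Finset.univ : Finset {A : Submodule K E // isK K k A}).card = gaussBinom (Nat.card K) (2*k) k := by
      rw [← hE, ← card_grass', Nat.card_eq_fintype_card, Finset.card_univ]
      apply Fintype.card_congr
      exact Equiv.subtypeEquivRight fun _ => Iff.rfl
    rw [h1, h2, smul_eq_mul, smul_eq_mul, hf] at this
    exact (Nat.eq_of_mul_eq_mul_left (gI_pos _ (by omega)) this).symm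
  · intro H _
    exact cnt_le_hyp' H.1 H.2
  · intro A _
    have := cnt_hyp hE A.1
    rw [show finrank K A.1 = k from A.2, show 2 * k - k = k by omega] at this
    exact this

end ithree
end EKR

namespace EKR
open Module Matrix

section ithree
variable {K : Type*} [Field K] [Finite K] {E : Type*} [AddCommGroup E] [Module K E] [Finite E]
set_option linter.unusedSectionVars false
open Classical

theorem sumY {k : ℕ} (hE : finrank K E = 2 * k) (y : {A : Submodule K E // isK K k A} → ℝ) :
    ∑ H : {H : Submodule K E // finrank K H + 1 = 2 * k},
      (∑ A ∈ Finset.univ.filter (fun A : {A : Submodule K E // isK K k A} => A.1 ≤ H.1), y A) ^ 2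
     = y ⬝ᵥ (cM K E k *ᵥ y) := by
  have : Module.Finite K E := Module.Finite.of_finite
  simp only [Finset.sum_filter, sq, Finset.sum_mul_sum]
  rw [Finset.sum_comm]
  simp only [dotProduct, mulVec, Finset.mul_sum]
  refine Finset.sum_congr rfl fun A _ => ?_
  rw [Finset.sum_comm]
  refine Finset.sum_congr rfl fun B _ => ?_
  have h := cnt_hyp hE (A.1 ⊔ B.1)
  have h2 := Submodule.finrank_sup_add_finrank_inf_eq A.1 B.1
  rw [show finrank K A.1 = k from A.2, show finrank K B.1 = k from B.2] at h2
  rw [cM_apply, show finrank K (A.1 ⊓ B.1 : Submodule K E) = 2 * k - finrank K (A.1 ⊔ B.1 : Submodule K E) by omega, ← h]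
  rw [← Finset.sum_boole, Finset.sum_mul, Finset.mul_sum]
  refine Finset.sum_congr rfl fun H _ => ?_
  simp only [sup_le_iff]
  by_cases h1 : A.1 ≤ H.1 <;> by_cases h2 : B.1 ≤ H.1 <;> simp [h1, h2]

theorem M2_rel {k : ℕ} (hk : 2 ≤ k) (hE : finrank K E = 2 * k) :
    gaussBinom (Nat.card K) (2*k-1) (k-1) * gI (Nat.card K) (k-1)
      = gI (Nat.card K) (2*k-1) * gaussBinom (Nat.card K) (2*k-2) (k-2) := by
  have : Module.Finite K E := Module.Finite.of_finite
  obtain ⟨f, hf⟩ := exists_linearIndependent_of_le_finrank (R := K) (M := E) (n := 2*k-1) (by omega)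
  have hA := finrank_span_eq_card hf
  rw [Fintype.card_fin] at hA
  have := flag_count (K := K) (E := Submodule.span K (Set.range f)) (k := k-1) (by omega)
  rw [hA] at this
  exact this

theorem I3 {k : ℕ} (hk : 2 ≤ k) (hE : finrank K E = 2 * k)
    (g : {A : Submodule K E // isK K k A} → {H : Submodule K E // finrank K H + 1 = 2 * k} → ℝ)
    (hg0 : ∀ A H, 0 ≤ g A H)
    (hs : ∀ A H, g A H ≠ 0 → A.1 ≤ H.1)
    (hint : ∀ A H A' H', g A H ≠ 0 → g A' H' ≠ 0 → A.1 ⊓ A'.1 ≠ ⊥)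
    (hineq : (gaussBinom (Nat.card K) (2*k-1) (k-1) : ℝ) * ∑ A, ∑ H, g A H ^ 2
      + ((Nat.card K : ℝ)^(2*k-1) - 1) * ∑ H, (∑ A, g A H) ^ 2
     ≤ (gaussBinom (Nat.card K) (2*k-1) (k-1) : ℝ) * (Nat.card K : ℝ)^(2*k-1) * ∑ A, ∑ H, g A H) :
    ∑ A, ∑ H, g A H ≤ (gaussBinom (Nat.card K) (2*k-1) (k-1) : ℝ) *
      ((Nat.card K : ℝ)^k * (gI (Nat.card K) k - 1) + 1) := by
  have hq2 : 2 ≤ Nat.card K := Finite.one_lt_card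
  set Q : ℝ := (Nat.card K : ℝ) with hQdef
  have hQ : 2 ≤ Q := by rw [hQdef]; exact_mod_cast hq2
  have hQ0 : 0 < Q := by linarith
  set M : ℝ := (gaussBinom (Nat.card K) (2*k-1) (k-1) : ℝ) with hMdef
  have hM : 0 < M := by
    rw [hMdef]; exact_mod_cast gauss_pos (K := K) (E := E) (by omega) hE
  set M2 : ℝ := (gaussBinom (Nat.card K) (2*k-2) (k-2) : ℝ) with hM2def
  set a : ℝ := (gI (Nat.card K) k : ℝ) with hadef
  set w : ℝ := Q ^ (2*k-1) with hw
  set S : ℝ := ∑ A, ∑ H, g A H with hSdef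
  set D : ℝ := Q ^ k * (a - 1) + 1 with hD
  have hqk : (Q - 1) * a = Q ^ k - 1 := gI_mul _ _
  have ha : 1 + Q ≤ a := by
    obtain ⟨d, rfl⟩ := Nat.exists_eq_add_of_le hk
    rw [hadef, gI_add]
    have : gI (Nat.card K) 2 = 1 + Nat.card K := by simp [gI, Finset.sum_range_succ]
    rw [this]; push_cast
    have : (0:ℝ) ≤ (Nat.card K : ℝ)^2 * gI (Nat.card K) d := by positivity
    linarith
  have ha0 : 0 < a := by linarith
  have hw1 : 1 ≤ w := one_le_pow₀ (by linarith)
  have hw0 : 0 < w := by linarith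
  have hk1 : 1 ≤ Q ^ k := one_le_pow₀ (by linarith)
  have hD0 : 0 < D := by nlinarith
  have hwQ : w * Q = (Q ^ k) ^ 2 := by
    rw [hw, ← pow_succ, ← pow_mul]; congr 1; omega
  set κ : ℝ := (w - 1) / M with hκ
  have hκM : κ * M = w - 1 := by rw [hκ, div_mul_cancel₀ _ hM.ne']
  have hκ0 : 0 ≤ κ := div_nonneg (by linarith) hM.le
  have hθ : κ / w * (M - M2) * Q ^ k = Q ^ k - 1 := by
    have h1 : M * (gI (Nat.card K) (k-1) : ℝ) = (gI (Nat.card K) (2*k-1) : ℝ) * M2 := by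
      rw [hMdef, hM2def]; exact_mod_cast M2_rel hk hE
    have h2 : (Q - 1) * (gI (Nat.card K) (2*k-1) : ℝ) = w - 1 := gI_mul _ _
    have h3 : (Q - 1) * (gI (Nat.card K) (k-1) : ℝ) = Q ^ (k-1) - 1 := gI_mul _ _
    have h4 : w = Q ^ (k-1) * Q ^ k := by rw [hw, ← pow_add]; congr 1; omega
    have h5 : κ * M2 = Q ^ (k-1) - 1 := by
      rw [hκ, ← h2, ← h3]
      field_simp
      linear_combination (-(Q-1)) * h1
    have h6 : κ * (M - M2) = Q ^ (k-1) * (Q ^ k - 1) := by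
      rw [mul_sub, h5, hκM, h4]; ring
    have : κ / w * (M - M2) * Q ^ k = κ * (M - M2) * Q ^ k / w := by ring
    rw [this, h6, div_eq_iff hw0.ne', h4]; ring
  -- decompose
  set f : {A : Submodule K E // isK K k A} → ℝ := fun A => ∑ H, g A H with hf
  obtain ⟨f01, hf01, hf2⟩ := exists_proj (lvl (isK K k) 2) f
  obtain ⟨f0, hf0, hf1⟩ := exists_proj (lvl (isK K k) 1) f01
  set f2 := f - f01 with hf2def
  set f1 := f01 - f0 with hf1def
  have hf0' : f0 ∈ lvl (isK K k) 2 := lvl_mono _ (by norm_num) hf0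
  have hf1' : f1 ∈ lvl (isK K k) 2 := Submodule.sub_mem _ hf01 hf0'
  have hdec : f = f0 + f1 + f2 := by rw [hf2def, hf1def]; abel
  have o01 : f0 ⬝ᵥ f1 = 0 := hf1 _ hf0
  have o10 : f1 ⬝ᵥ f0 = 0 := by rw [dotProduct_comm]; exact o01
  have o02 : f0 ⬝ᵥ f2 = 0 := hf2 _ hf0'
  have o20 : f2 ⬝ᵥ f0 = 0 := by rw [dotProduct_comm]; exact o02
  have o12 : f1 ⬝ᵥ f2 = 0 := hf2 _ hf1'
  have o21 : f2 ⬝ᵥ f1 = 0 := by rw [dotProduct_comm]; exact o12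
  set n0 := f0 ⬝ᵥ f0 with hn0
  set n1 := f1 ⬝ᵥ f1 with hn1
  set n2 := f2 ⬝ᵥ f2 with hn2
  have hn2' : 0 ≤ n2 := by
    rw [hn2, dotProduct]; exact Finset.sum_nonneg fun i _ => mul_self_nonneg _
  -- Kneser form
  have hknf : f ⬝ᵥ (kn (isK K k) *ᵥ f) = 0 := by
    simp only [dotProduct, mulVec, Finset.mul_sum]
    apply Finset.sum_eq_zero; intro A _
    apply Finset.sum_eq_zero; intro B _
    by_cases hA : f A = 0
    · rw [hA, zero_mul]
    by_cases hB : f B = 0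
    · rw [hB, mul_zero, mul_zero]
    obtain ⟨H, -, hH⟩ := Finset.exists_ne_zero_of_sum_ne_zero hA
    obtain ⟨H', -, hH'⟩ := Finset.exists_ne_zero_of_sum_ne_zero hB
    have := hint A H B H' hH hH'
    simp [kn, this]
  have hkn : Q ^ k * n0 ≤ n1 + n2 / Q := by
    have k0 := kn_form hE 0 f0 hf0 (by
      intro w hw; rw [lvl_zero, Submodule.mem_bot] at hw; simp [hw])
    have k1 := kn_form hE 1 f1 hf1' hf1
    have k2 := kn_lower hk hE f2 hf2
    have c01 : f1 ⬝ᵥ (kn (isK K k) *ᵥ f0) = 0 := by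
      rw [dotProduct_comm]; exact hf1 _ (kn_inv hE 1 _ hf0)
    have c10 : f0 ⬝ᵥ (kn (isK K k) *ᵥ f1) = 0 := by rw [symm_dot (kn_symm _)]; exact c01
    have c02 : f2 ⬝ᵥ (kn (isK K k) *ᵥ f0) = 0 := by
      rw [dotProduct_comm]; exact hf2 _ (kn_inv hE 2 _ hf0')
    have c20 : f0 ⬝ᵥ (kn (isK K k) *ᵥ f2) = 0 := by rw [symm_dot (kn_symm _)]; exact c02
    have c12 : f2 ⬝ᵥ (kn (isK K k) *ᵥ f1) = 0 := by
      rw [dotProduct_comm]; exact hf2 _ (kn_inv hE 2 _ hf1')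
    have c21 : f1 ⬝ᵥ (kn (isK K k) *ᵥ f2) = 0 := by rw [symm_dot (kn_symm _)]; exact c12
    rw [hdec] at hknf
    simp only [mulVec_add, dotProduct_add, add_dotProduct, c01, c10, c02, c20, c12, c21, k0, k1] at hknf
    have m0 : mu (Nat.card K) 0 = 1 := by simp [mu]
    have m1 : mu (Nat.card K) 1 = -1 := by simp [mu]
    rw [m0, m1] at hknf
    have e0 : (Nat.card K : ℝ) ^ (k * (k - 0)) = Q ^ (k*(k-1)) * Q ^ k := by
      rw [← hQdef, ← pow_add]; congr 1
      obtain ⟨d, rfl⟩ := Nat.exists_eq_add_of_le hk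
      rw [show 2 + d - 1 = d + 1 by omega]; simp; ring
    rw [e0, ← hQdef] at hknf
    rw [← hQdef] at k2
    have hY : 0 < Q ^ (k*(k-1)) := by positivity
    rw [← mul_le_mul_iff_right₀ hY]
    have : Q ^ (k*(k-1)) * (n1 + n2 / Q) = Q ^ (k*(k-1)) * n1 + Q ^ (k*(k-1)) / Q * n2 := by ring
    rw [this]
    linarith
  -- n0
  obtain ⟨c, hc⟩ : ∃ c : ℝ, f0 = c • 1 := by
    have : lvl (isK K k (E := E)) 1 ≤ Submodule.span ℝ {1} := by
      apply Submodule.span_le.2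
      rintro _ ⟨T, hT, rfl⟩
      have : Module.Finite K E := Module.Finite.of_finite
      have : T = ⊥ := Submodule.finrank_eq_zero.1 (by omega)
      rw [this, chi_bot]
      exact Submodule.mem_span_singleton_self _
    obtain ⟨c, hc⟩ := Submodule.mem_span_singleton.1 (this hf0)
    exact ⟨c, hc.symm⟩
  have hone : (1 : {A : Submodule K E // isK K k A} → ℝ) ∈ lvl (isK K k) 1 := by
    rw [← chi_bot]; exact chi_mem _ (by rw [finrank_bot]; omega)
  have hN : (1 : {A : Submodule K E // isK K k A} → ℝ) ⬝ᵥ 1 = (Q ^ k + 1) * M := by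
    have h1 := cnt_ge (⊥ : Submodule K E) k (by rw [finrank_bot]; omega)
    have h2 := Nq_eq (K := K) (E := E) (by omega) hE
    rw [finrank_bot, hE, Nat.sub_zero, Nat.sub_zero, h2] at h1
    rw [← chi_bot, chi_dot, sup_idem, h1, hQdef, hMdef]; push_cast; ring
  have hcS : c * ((Q ^ k + 1) * M) = S := by
    have h1 : (1 : {A : Submodule K E // isK K k A} → ℝ) ⬝ᵥ f = S := by
      simp [dotProduct, hf, hSdef]
    rw [hdec, dotProduct_add, dotProduct_add, hf1 _ hone, hf2 _ (lvl_mono _ (by norm_num) hone), hc,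
      dotProduct_smul, hN, smul_eq_mul, add_zero, add_zero] at h1
    exact h1
  have hn0S : n0 * ((Q ^ k + 1) * M) = S ^ 2 := by
    rw [hn0, hc, dotProduct_smul, smul_dotProduct, hN, smul_eq_mul, smul_eq_mul, ← hcS]; ring
  -- main inequality
  set c0 := w / a with hc0
  set η := Q ^ k / D with hη
  set y := c0 • f0 + η • f1 + (1/a) • f2 with hy
  have hmain := abs_sum (fun (A : {A : Submodule K E // isK K k A}) (H : {H : Submodule K E // finrank K H + 1 = 2 * k}) => A.1 ≤ H.1)
    g hs (gI (Nat.card K) k) (gaussBinom (Nat.card K) (2*k-1) (k-1)) (by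
      intro A
      have := cnt_hyp hE A.1
      rw [show finrank K A.1 = k from A.2, show 2 * k - k = k by omega] at this
      exact this) (fun H => cnt_le_hyp hk hE H.1 H.2) κ w hκ0 (by rw [← hMdef, hκM]; ring) y
  rw [sumY hE] at hmain
  have y1 : ∑ A, y A * ∑ H, g A H = c0 * n0 + η * n1 + 1/a * n2 := by
    change y ⬝ᵥ f = _
    rw [hdec, hy]
    simp only [dotProduct_add, add_dotProduct, smul_dotProduct, o01, o10, o02, o20, o12, o21, smul_eq_mul]
    ring
  have y2 : ∑ A, y A ^ 2 = c0^2 * n0 + η^2 * n1 + (1/a)^2 * n2 := by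
    have : ∑ A, y A ^ 2 = y ⬝ᵥ y := by simp [dotProduct, sq]
    rw [this, hy]
    simp only [dotProduct_add, add_dotProduct, smul_dotProduct, dotProduct_smul, o01, o10, o02, o20, o12, o21, smul_eq_mul]
    ring
  have y3 : y ⬝ᵥ (cM K E k *ᵥ y) = c0^2 * (a * M * n0) + η^2 * ((M - M2) * n1) := by
    have z2 := cM_orth k f2 hf2
    have z0 := cM_form0 hk hE f0 hf0
    have z1 := cM_form1 hk hE f1 hf1' hf1
    have z01 : f0 ⬝ᵥ (cM K E k *ᵥ f1) = 0 := by
      rw [symm_dot (cM_symm k), z0, dotProduct_smul, o10, smul_zero]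
    have z21 : f2 ⬝ᵥ (cM K E k *ᵥ f1) = 0 := by
      rw [symm_dot (cM_symm k), z2, dotProduct_zero]
    rw [hy]
    simp only [mulVec_add, mulVec_smul, z2, z0]
    simp only [dotProduct_add, add_dotProduct, smul_dotProduct, dotProduct_smul, dotProduct_zero, o01, o10, o02, o20, o12, o21, smul_eq_mul, z01, z21, z1]
    ring
  rw [y1, y2, y3] at hmain
  have hub : ∑ A, ∑ H, g A H ^ 2 + κ * ∑ H, (∑ A, g A H) ^ 2 ≤ w * S := by
    rw [← mul_le_mul_iff_right₀ hM]
    have : M * (∑ A, ∑ H, g A H ^ 2 + κ * ∑ H, (∑ A, g A H) ^ 2) = M * ∑ A, ∑ H, g A H ^ 2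
      + (w - 1) * ∑ H, (∑ A, g A H) ^ 2 := by rw [← hκM]; ring
    rw [this]
    linarith
  have hLB : w / a * n0 + Q ^ k / D * n1 + n2 / a ≤ w * S := by
    refine le_trans (le_of_eq ?_) (hmain.trans hub)
    have q0 : 2 * c0 - a * c0^2 + κ / w * (c0^2 * (a * M)) = w / a := by
      have : κ / w * (c0^2 * (a * M)) = (κ * M) * (c0^2 * a) / w := by ring
      rw [this, hκM, hc0]
      field_simp
      ring
    have q1 : 2 * η - a * η^2 + κ / w * (η^2 * (M - M2)) = Q ^ k / D := by
      have hk0 : Q ^ k ≠ 0 := by positivity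
      have e1 : κ / w * (M - M2) = (Q ^ k - 1) / Q ^ k := by
        rw [eq_div_iff hk0, hθ]
      have : κ / w * (η^2 * (M - M2)) = η^2 * (κ / w * (M - M2)) := by ring
      rw [this, e1]
      have e2 : a - (Q ^ k - 1) / Q ^ k = D / Q ^ k := by rw [hD]; field_simp; ring
      have e3 : 2 * η - a * η^2 + η^2 * ((Q ^ k - 1) / Q ^ k) = 2 * η - η^2 * (D / Q ^ k) := by rw [← e2]; ring
      rw [e3, hη]
      field_simp
      ring
    have q2 : 2 * (1/a) - a * (1/a)^2 = 1 / a := by field_simp; ring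
    rw [← q0, ← q1, ← hadef]
    linear_combination -n2 * q2
  exact final_num Q a w (Q ^ k) D M ((Q ^ k + 1) * M) S n0 n1 n2 hQ ha hqk hwQ hD hM rfl
    (Finset.sum_nonneg fun A _ => Finset.sum_nonneg fun H _ => hg0 A H) hn2' hn0S hkn hLB

end ithree
end EKR

namespace EKR
open Module

theorem card_split {A B : Type*} [AddCommGroup A] [AddCommGroup B] (f : A →+ B)
    (U : AddSubgroup A) :
    Nat.card U = Nat.card (U.map f) * Nat.card (U ⊓ f.ker : AddSubgroup A) := by
  let g : U →+ B := f.comp U.subtype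
  rw [AddSubgroup.card_eq_card_quotient_mul_card_addSubgroup g.ker,
    Nat.card_congr (QuotientAddGroup.quotientKerEquivRange g).toEquiv]
  congr 1
  · have : g.range = U.map f := by
      ext x; simp [g]
    rw [this]
  · refine Nat.card_congr ⟨fun x => ⟨x.1.1, x.1.2, x.2⟩, fun x => ⟨⟨x.1, x.2.1⟩, x.2.2⟩, fun x => rfl, fun x => rfl⟩

section ringside
variable {R : Type*} [Ring R] {K : Type*} [Field K] {π : R →+* K} [RingHomSurjective π]
open Classical

theorem card_split' {A B : Type*} [AddCommGroup A] [Module R A] [AddCommGroup B] [Module K B]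
    (f : A →ₛₗ[π] B) (U : Submodule R A) :
    Nat.card U = Nat.card (U.map f) * Nat.card (U ⊓ LinearMap.ker f : Submodule R A) :=
  card_split f.toAddMonoidHom U.toAddSubgroup

theorem finrank_of_card [Finite K] {B : Type*} [AddCommGroup B] [Module K B] [Finite B] {n : ℕ}
    (h : Nat.card B = Nat.card K ^ n) : finrank K B = n := by
  have : Module.Finite K B := Module.Finite.of_finite
  rw [Module.natCard_eq_pow_finrank (K := K)] at h
  exact Nat.pow_right_injective (Finite.one_lt_card) h

theorem class_aux [Finite K] {M W : Type*} [AddCommGroup M] [Module R M] [Finite M]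
    [AddCommGroup W] [Module K W] [Finite W] (φ : M →ₛₗ[π] W) (hφ : Function.Surjective φ)
    (Z : Submodule R M) {k : ℕ} (hk : 2 ≤ k)
    (hM : Nat.card M = Nat.card K ^ (2*k) * Nat.card (LinearMap.ker φ))
    (h0Z : LinearMap.ker φ ≤ Z) (hZ : Nat.card Z = Nat.card K * Nat.card (LinearMap.ker φ))
    (𝒰 : Finset (Submodule R M))
    (hU : ∀ U ∈ 𝒰, U ⊓ Z = LinearMap.ker φ ∧ Nat.card U = Nat.card K ^ k * Nat.card (LinearMap.ker φ))
    (hint : ∀ U ∈ 𝒰, ∀ U' ∈ 𝒰, ∃ x ∈ U ⊓ U', x ∉ LinearMap.ker φ) :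
    (gaussBinom (Nat.card K) (2*k-1) (k-1) : ℝ) *
      ∑ U ∈ 𝒰, ∑ U' ∈ 𝒰, (if U ⊔ Z = U' ⊔ Z then (1:ℝ) else 0)
      + ((Nat.card K : ℝ)^(2*k-1) - 1) * (𝒰.card : ℝ)^2
      ≤ (gaussBinom (Nat.card K) (2*k-1) (k-1) : ℝ) * (Nat.card K : ℝ)^(2*k-1) * 𝒰.card := by
  have hpos : 0 < Nat.card (LinearMap.ker φ) := Nat.card_pos
  have key : ∀ U : Submodule R M, LinearMap.ker φ ≤ U → ∀ n, Nat.card U = n * Nat.card (LinearMap.ker φ) →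
      Nat.card (U.map φ) = n := by
    intro U h n hn
    have := card_split' φ U
    rw [inf_eq_right.2 h, hn] at this
    exact (Nat.eq_of_mul_eq_mul_right hpos this).symm
  have hle : ∀ U ∈ 𝒰, LinearMap.ker φ ≤ U := fun U h => (hU U h).1 ▸ inf_le_left
  have hcm : ∀ U : Submodule R M, LinearMap.ker φ ≤ U → (U.map φ).comap φ = U := by
    intro U h
    rw [Submodule.comap_map_eq, sup_eq_left.2 h]
  have hE : finrank K W = 2 * k := by
    apply finrank_of_card
    have := card_split' φ (⊤ : Submodule R M)
    rw [Submodule.map_top, LinearMap.range_eq_top.2 hφ, top_inf_eq] at this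
    have e1 : Nat.card (⊤ : Submodule R M) = Nat.card M := Nat.card_congr Submodule.topEquiv.toEquiv
    have e2 : Nat.card (⊤ : Submodule K W) = Nat.card W := Nat.card_congr Submodule.topEquiv.toEquiv
    rw [e1, e2, hM] at this
    exact (Nat.eq_of_mul_eq_mul_right hpos this).symm
  have hL : finrank K (Z.map φ) = 1 := by
    apply finrank_of_card
    rw [key Z h0Z _ hZ, pow_one]
  have hinj : Set.InjOn (fun U : Submodule R M => U.map φ) 𝒰 := by
    intro U h U' h' e
    rw [← hcm U (hle U h), ← hcm U' (hle U' h')]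
    exact congrArg _ e
  have := I1 hk hE hL (𝒰.image (fun U => U.map φ)) ?_ ?_
  · rw [Finset.sum_image hinj, Finset.card_image_of_injOn hinj] at this
    refine le_trans (le_of_eq ?_) this
    congr 2
    refine Finset.sum_congr rfl fun U h => ?_
    rw [Finset.sum_image hinj]
    refine Finset.sum_congr rfl fun U' h' => ?_
    refine if_congr ?_ rfl rfl
    rw [← Submodule.map_sup, ← Submodule.map_sup]
    constructor
    · intro e; rw [e]
    · intro e
      rw [← hcm (U ⊔ Z) ((hle U h).trans le_sup_left), ← hcm (U' ⊔ Z) ((hle U' h').trans le_sup_left), e]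
  · intro C hC
    obtain ⟨U, h, rfl⟩ := Finset.mem_image.1 hC
    refine ⟨finrank_of_card (key U (hle U h) _ (hU U h).2), ?_⟩
    rw [eq_bot_iff]
    rintro _ ⟨⟨z, hz, rfl⟩, u, hu, e⟩
    have : u - z ∈ LinearMap.ker φ := by simp [e]
    have hz' : z ∈ U := by
      have := U.sub_mem hu (hle U h this)
      simpa using this
    have : z ∈ U ⊓ Z := ⟨hz', hz⟩
    rw [(hU U h).1] at this
    simpa using this
  · intro C hC C' hC'
    obtain ⟨U, h, rfl⟩ := Finset.mem_image.1 hC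
    obtain ⟨U', h', rfl⟩ := Finset.mem_image.1 hC'
    obtain ⟨x, hx, hn⟩ := hint U h U' h'
    intro hb
    apply hn
    have : φ x ∈ U.map φ ⊓ U'.map φ := ⟨⟨x, hx.1, rfl⟩, ⟨x, hx.2, rfl⟩⟩
    rw [hb] at this
    simpa using this

theorem class_gen [Finite K] {M : Type*} [AddCommGroup M] [Module R M] [Finite M]
    (H0 Z : Submodule R M) {k : ℕ} (hk : 2 ≤ k)
    (hann : ∀ n : R, π n = 0 → ∀ v : M, n • v ∈ H0)
    (hM : Nat.card M = Nat.card K ^ (2*k) * Nat.card H0)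
    (h0Z : H0 ≤ Z) (hZ : Nat.card Z = Nat.card K * Nat.card H0)
    (𝒰 : Finset (Submodule R M))
    (hU : ∀ U ∈ 𝒰, U ⊓ Z = H0 ∧ Nat.card U = Nat.card K ^ k * Nat.card H0)
    (hint : ∀ U ∈ 𝒰, ∀ U' ∈ 𝒰, ∃ x ∈ U ⊓ U', x ∉ H0) :
    (gaussBinom (Nat.card K) (2*k-1) (k-1) : ℝ) *
      ∑ U ∈ 𝒰, ∑ U' ∈ 𝒰, (if U ⊔ Z = U' ⊔ Z then (1:ℝ) else 0)
      + ((Nat.card K : ℝ)^(2*k-1) - 1) * (𝒰.card : ℝ)^2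
      ≤ (gaussBinom (Nat.card K) (2*k-1) (k-1) : ℝ) * (Nat.card K : ℝ)^(2*k-1) * 𝒰.card := by
  have hs : Function.Surjective π := RingHomSurjective.is_surjective
  let _ : SMul K (M ⧸ H0) := ⟨fun c x => Function.surjInv hs c • x⟩
  have hsm : ∀ (c : R) (x : M ⧸ H0), π c • x = c • x := by
    intro c x
    obtain ⟨v, rfl⟩ := Submodule.mkQ_surjective H0 x
    change Function.surjInv hs (π c) • H0.mkQ v = c • H0.mkQ v
    rw [← sub_eq_zero, ← sub_smul, ← map_smul]
    simp only [Submodule.mkQ_apply, Submodule.Quotient.mk_eq_zero]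
    exact hann _ (by rw [map_sub, Function.surjInv_eq hs, sub_self]) v
  let _ : Module K (M ⧸ H0) := Function.Surjective.moduleLeft π hs hsm
  have : Finite (M ⧸ H0) := Finite.of_surjective _ (Submodule.mkQ_surjective H0)
  let φ : M →ₛₗ[π] (M ⧸ H0) :=
    { toFun := fun v => H0.mkQ v
      map_add' := fun a b => map_add _ a b
      map_smul' := fun c v => by rw [hsm, map_smul] }
  have hker : LinearMap.ker φ = H0 := by
    ext v
    exact Submodule.Quotient.mk_eq_zero H0
  have := class_aux φ (Submodule.mkQ_surjective H0) Z hk (by rw [hker]; exact hM)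
    (by rw [hker]; exact h0Z) (by rw [hker]; exact hZ) 𝒰 (by rw [hker]; exact hU) (by rw [hker]; exact hint)
  exact this

end ringside
end EKR

namespace EKR
open Module

section fib
open Classical
variable {α β : Type*} {p : α → Prop} [Fintype {a : α // p a}]

theorem fib_one (S : Finset β) (f : β → α) (hf : ∀ U ∈ S, p (f U)) :
    ∑ a : {a : α // p a}, ((S.filter (fun U => f U = a.1)).card : ℝ) = S.card := by
  have : ∀ a : {a : α // p a}, ((S.filter (fun U => f U = a.1)).card : ℝ)
      = ∑ U ∈ S, if f U = a.1 then (1:ℝ) else 0 := fun a => by rw [Finset.sum_boole]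
  simp only [this]
  rw [Finset.sum_comm, Finset.card_eq_sum_ones, Nat.cast_sum]
  refine Finset.sum_congr rfl fun U hU => ?_
  rw [Finset.sum_eq_single ⟨f U, hf U hU⟩]
  · simp
  · intro b _ hb
    rw [if_neg]
    intro e
    exact hb (Subtype.ext e.symm)
  · simp

theorem fib_two (S : Finset β) (f : β → α) (hf : ∀ U ∈ S, p (f U)) :
    ∑ a : {a : α // p a}, ((S.filter (fun U => f U = a.1)).card : ℝ)^2
      = ∑ U ∈ S, ∑ U' ∈ S, if f U = f U' then (1:ℝ) else 0 := by
  have : ∀ a : {a : α // p a}, ((S.filter (fun U => f U = a.1)).card : ℝ)^2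
      = ∑ U ∈ S, ∑ U' ∈ S, (if f U = a.1 then (1:ℝ) else 0) * (if f U' = a.1 then (1:ℝ) else 0) := by
    intro a
    rw [← Finset.sum_mul_sum, Finset.sum_boole, sq]
  simp only [this]
  rw [Finset.sum_comm]
  refine Finset.sum_congr rfl fun U hU => ?_
  rw [Finset.sum_comm]
  refine Finset.sum_congr rfl fun U' hU' => ?_
  rw [Finset.sum_eq_single ⟨f U, hf U hU⟩]
  · simp [eq_comm]
  · intro b _ hb
    rw [if_neg, zero_mul]
    intro e
    exact hb (Subtype.ext e.symm)
  · simp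
end fib

structure ChainData {R K : Type*} [Ring R] [Field K] (π : R →+* K) (θ : R) : Prop where
  left : ∀ r, θ * r = 0 ↔ π r = 0
  exl : ∀ n, π n = 0 → ∃ r, n = r * θ
  exr : ∀ n, π n = 0 → ∃ r, n = θ * r
  th : π θ = 0

section ringside
set_option linter.unusedSectionVars false
variable {R : Type*} [Ring R] [Finite R] {K : Type*} [Field K] [Finite K] (π : R →+* K)
  [RingHomSurjective π] {θ : R} {m : ℕ}
open Classical

def piV (m : ℕ) : (Fin m → R) →ₛₗ[π] (Fin m → K) where
  toFun v i := π (v i)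
  map_add' _ _ := by ext; simp
  map_smul' _ _ := by ext; simp

def thM (θ : R) (m : ℕ) : (Fin m → R) →+ (Fin m → R) where
  toFun v := θ • v
  map_zero' := smul_zero _
  map_add' _ _ := smul_add _ _ _

def Zs (m : ℕ) : Submodule R (Fin m → R) := LinearMap.ker (piV π m)

theorem mem_Zs (v : Fin m → R) : v ∈ Zs π m ↔ ∀ i, π (v i) = 0 := by
  simp only [Zs, LinearMap.mem_ker]
  exact funext_iff

def Hp (U : Submodule R (Fin m → R)) : Submodule R (Fin m → R) where
  carrier := {v | ∀ n, π n = 0 → n • v ∈ U}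
  zero_mem' n _ := by rw [smul_zero]; exact U.zero_mem
  add_mem' ha hb n hn := by rw [smul_add]; exact U.add_mem (ha n hn) (hb n hn)
  smul_mem' r v hv n hn := by
    rw [← mul_smul]
    exact hv _ (by rw [map_mul, hn, zero_mul])

theorem mem_Hp {U : Submodule R (Fin m → R)} {v} : v ∈ Hp π U ↔ ∀ n, π n = 0 → n • v ∈ U := Iff.rfl

theorem le_Hp (U : Submodule R (Fin m → R)) : U ≤ Hp π U := fun _ hv n _ => U.smul_mem n hv

variable {π} (D : ChainData π θ)
include D

theorem smul_Z {n : R} (hn : π n = 0) {z : Fin m → R} (hz : z ∈ Zs π m) : n • z = 0 := by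
  ext i
  obtain ⟨r, rfl⟩ := D.exl n hn
  have := (D.left (z i)).2 ((mem_Zs π z).1 hz i)
  simp [mul_assoc, this]

theorem Z_le_Hp (U : Submodule R (Fin m → R)) : Zs π m ≤ Hp π U := fun z hz n hn => by
  rw [smul_Z D hn hz]; exact U.zero_mem

theorem ker_thM : ((thM θ m).ker : Set (Fin m → R)) = Zs π m := by
  ext v
  simp only [SetLike.mem_coe, AddMonoidHom.mem_ker, mem_Zs]
  change θ • v = 0 ↔ _
  rw [funext_iff]
  exact forall_congr' fun i => D.left (v i)

theorem smul_mem_Z (v : Fin m → R) : θ • v ∈ Zs π m := by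
  rw [mem_Zs]; intro i; simp [D.th]

theorem exists_Z {z : Fin m → R} (hz : z ∈ Zs π m) : ∃ v, z = θ • v := by
  rw [mem_Zs] at hz
  choose v hv using fun i => D.exr _ (hz i)
  exact ⟨v, funext hv⟩

theorem inf_Z (U : Submodule R (Fin m → R)) :
    ((U ⊓ Zs π m : Submodule R (Fin m → R)) : Set (Fin m → R)) = (fun v => θ • v) '' (Hp π U) := by
  ext z
  constructor
  · rintro ⟨hU, hz⟩
    obtain ⟨v, rfl⟩ := exists_Z D hz
    refine ⟨v, ?_, rfl⟩
    intro n hn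
    obtain ⟨r, rfl⟩ := D.exl n hn
    rw [mul_smul]
    exact U.smul_mem _ hU
  · rintro ⟨v, hv, rfl⟩
    exact ⟨hv θ D.th, smul_mem_Z D v⟩

theorem inf_Z_congr {U U' : Submodule R (Fin m → R)} (h : Hp π U = Hp π U') :
    U ⊓ Zs π m = U' ⊓ Zs π m := by
  apply SetLike.coe_injective
  rw [inf_Z D, inf_Z D, h]

theorem card_Hp (U : Submodule R (Fin m → R)) :
    Nat.card (Hp π U) = Nat.card (U ⊓ Zs π m : Submodule R (Fin m → R)) * Nat.card (Zs π m) := by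
  have := card_split (thM θ m) (Hp π U).toAddSubgroup
  have e1 : Nat.card ((Hp π U).toAddSubgroup.map (thM θ m)) = Nat.card (U ⊓ Zs π m : Submodule R (Fin m → R)) := by
    refine Nat.card_congr (Equiv.subtypeEquivRight fun x => ?_)
    exact (Set.ext_iff.1 (inf_Z D U) x).symm
  have e2 : Nat.card ((Hp π U).toAddSubgroup ⊓ (thM θ m).ker : AddSubgroup _) = Nat.card (Zs π m) := by
    refine Nat.card_congr (Equiv.subtypeEquivRight fun x => ?_)
    have h := Set.ext_iff.1 (ker_thM (m := m) D) x
    exact ⟨fun hx => h.1 hx.2, fun hx => ⟨Z_le_Hp D U hx, h.2 hx⟩⟩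
  rw [e1, e2] at this
  exact this

theorem card_Z : Nat.card (Zs π m) = Nat.card K ^ m := by
  have h1 := card_Hp (m := m) D (⊤ : Submodule R (Fin m → R))
  rw [top_inf_eq] at h1
  have h2 : Hp π (⊤ : Submodule R (Fin m → R)) = ⊤ := eq_top_iff.2 (le_Hp π ⊤)
  rw [h2, card_split' (piV π m), Submodule.map_top, LinearMap.range_eq_top.2, top_inf_eq] at h1
  · have h3 := Nat.eq_of_mul_eq_mul_right (Nat.card_pos (α := Zs π m)) h1
    rw [← h3]
    rw [Nat.card_congr (Submodule.topEquiv (R := K) (M := Fin m → K)).toEquiv, Nat.card_fun, Nat.card_fin]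
  · intro w
    choose v hv using fun i => (RingHomSurjective.is_surjective (σ := π)) (w i)
    exact ⟨v, funext hv⟩

theorem class_bound {k : ℕ} (hk : 2 ≤ k) (𝓕 : Finset (Submodule R (Fin (2*k) → R)))
    (hc : ∀ U ∈ 𝓕, Nat.card U = Nat.card K ^ (3*k-1))
    (hc' : ∀ U ∈ 𝓕, Nat.card (U ⊓ Zs π (2*k) : Submodule R (Fin (2*k) → R)) = Nat.card K ^ (2*k-1))
    (hint : ∀ U ∈ 𝓕, ∀ U' ∈ 𝓕, ∃ x ∈ U ⊓ U', x ∉ Zs π (2*k))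
    (S : Submodule R (Fin (2*k) → R)) (hS : ∀ U ∈ 𝓕, Hp π U = S) :
    (gaussBinom (Nat.card K) (2*k-1) (k-1) : ℝ) *
      ∑ U ∈ 𝓕, ∑ U' ∈ 𝓕, (if U.map (piV π _) = U'.map (piV π _) then (1:ℝ) else 0)
      + ((Nat.card K : ℝ)^(2*k-1) - 1) * (𝓕.card : ℝ)^2
      ≤ (gaussBinom (Nat.card K) (2*k-1) (k-1) : ℝ) * (Nat.card K : ℝ)^(2*k-1) * 𝓕.card := by
  rcases 𝓕.eq_empty_or_nonempty with rfl | ⟨U0, h0⟩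
  · simp
  have hUS : ∀ U ∈ 𝓕, U ≤ S := fun U h => (hS U h) ▸ le_Hp π U
  have hZS : Zs π (2*k) ≤ S := (hS U0 h0) ▸ Z_le_Hp D U0
  have hcs : ∀ T : Submodule R (Fin (2*k) → R), T ≤ S → Nat.card (T.submoduleOf S) = Nat.card T :=
    fun T h => Nat.card_congr (Submodule.submoduleOfEquivOfLe h).toEquiv
  have hinj : Set.InjOn (fun U : Submodule R (Fin (2*k) → R) => U.submoduleOf S) 𝓕 := by
    intro U h U' h' e
    have := congrArg (Submodule.map S.subtype) e
    simp only [Submodule.submoduleOf, Submodule.map_comap_subtype] at this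
    rwa [inf_eq_right.2 (hUS U h), inf_eq_right.2 (hUS U' h')] at this
  have hH0 : Nat.card ((U0 ⊓ Zs π (2*k)).submoduleOf S) = Nat.card K ^ (2*k-1) := by
    rw [hcs _ (inf_le_left.trans (hUS U0 h0)), hc' U0 h0]
  have := class_gen (π := π) ((U0 ⊓ Zs π (2*k)).submoduleOf S) ((Zs π (2*k)).submoduleOf S) hk
    ?_ ?_ ?_ ?_ (𝓕.image (fun U => U.submoduleOf S)) ?_ ?_
  · rw [Finset.sum_image hinj, Finset.card_image_of_injOn hinj] at this
    refine le_trans ?_ this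
    gcongr with U h
    rw [Finset.sum_image hinj]
    gcongr with U' h'
    split_ifs with h1 h2
    · exact le_rfl
    · exfalso
      apply h2
      rw [← Submodule.submoduleOf_sup_of_le (hUS U h) hZS, ← Submodule.submoduleOf_sup_of_le (hUS U' h') hZS]
      have := congrArg (Submodule.comap (piV π _)) h1
      rw [Submodule.comap_map_eq, Submodule.comap_map_eq] at this
      exact congrArg (fun T => Submodule.submoduleOf T S) this
    · norm_num
    · exact le_rfl
  · intro n hn v
    have hv : v.1 ∈ Hp π U0 := by rw [hS U0 h0]; exact v.2
    refine ⟨hv n hn, ?_⟩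
    change n • v.1 ∈ Zs π (2*k)
    rw [mem_Zs]
    intro i
    simp [hn]
  · rw [hH0, ← hS U0 h0, card_Hp D, card_Z D, hc' U0 h0, mul_comm]
  · exact Submodule.comap_mono inf_le_right
  · rw [hcs _ hZS, card_Z D, hH0, ← pow_succ']
    congr 1; omega
  · intro C hC
    obtain ⟨U, h, rfl⟩ := Finset.mem_image.1 hC
    constructor
    · rw [inf_Z_congr D ((hS U0 h0).trans (hS U h).symm)]
      exact (Submodule.comap_inf _ _ _).symm
    · rw [hH0, hcs _ (hUS U h), hc U h, ← pow_add]
      congr 1; omega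
  · intro C hC C' hC'
    obtain ⟨U, h, rfl⟩ := Finset.mem_image.1 hC
    obtain ⟨U', h', rfl⟩ := Finset.mem_image.1 hC'
    obtain ⟨x, hx, hn⟩ := hint U h U' h'
    exact ⟨⟨x, hUS U h hx.1⟩, ⟨hx.1, hx.2⟩, fun hh => hn hh.2⟩

theorem abs_main {k : ℕ} (hk : 2 ≤ k) (𝓕 : Finset (Submodule R (Fin (2*k) → R)))
    (hc : ∀ U ∈ 𝓕, Nat.card U = Nat.card K ^ (3*k-1))
    (hc' : ∀ U ∈ 𝓕, Nat.card (U ⊓ Zs π (2*k) : Submodule R (Fin (2*k) → R)) = Nat.card K ^ (2*k-1))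
    (hint : ∀ U ∈ 𝓕, ∀ U' ∈ 𝓕, ∃ x ∈ U ⊓ U', x ∉ Zs π (2*k)) :
    (𝓕.card : ℝ) ≤ (gaussBinom (Nat.card K) (2*k-1) (k-1) : ℝ) *
      ((Nat.card K : ℝ)^k * ((gI (Nat.card K) k : ℝ) - 1) + 1) := by
  have hqp : 0 < Nat.card K := Nat.card_pos
  let fA : Submodule R (Fin (2*k) → R) → Submodule K (Fin (2*k) → K) := fun U => U.map (piV π _)
  let fH : Submodule R (Fin (2*k) → R) → Submodule K (Fin (2*k) → K) := fun U => (Hp π U).map (piV π _)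
  have hA : ∀ U ∈ 𝓕, isK K k (fA U) := by
    intro U h
    apply finrank_of_card
    have := card_split' (piV π _) U
    rw [hc U h, show LinearMap.ker (piV π (2*k)) = Zs π (2*k) from rfl, hc' U h,
      show 3*k-1 = k + (2*k-1) by omega, pow_add] at this
    exact (Nat.eq_of_mul_eq_mul_right (by positivity) this).symm
  have hH : ∀ U ∈ 𝓕, finrank K (fH U) + 1 = 2*k := by
    intro U h
    have : finrank K (fH U) = 2*k-1 := by
      apply finrank_of_card
      have := card_split' (piV π _) (Hp π U)
      rw [card_Hp D, hc' U h, show LinearMap.ker (piV π (2*k)) = Zs π (2*k) from rfl,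
        inf_eq_right.2 (Z_le_Hp D U)] at this
      exact (Nat.eq_of_mul_eq_mul_right (Nat.card_pos) this).symm
    omega
  have hHH : ∀ U U', fH U = fH U' → Hp π U = Hp π U' := by
    intro U U' e
    have := congrArg (Submodule.comap (piV π _)) e
    simp only [fH, Submodule.comap_map_eq] at this
    rw [show LinearMap.ker (piV π (2*k)) = Zs π (2*k) from rfl,
        sup_eq_left.2 (Z_le_Hp D U), sup_eq_left.2 (Z_le_Hp D U')] at this
    exact this
  let g : {A : Submodule K (Fin (2*k) → K) // isK K k A} →
      {H : Submodule K (Fin (2*k) → K) // finrank K H + 1 = 2*k} → ℝ := fun A H =>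
    (((𝓕.filter (fun U => fH U = H.1)).filter (fun U => fA U = A.1)).card : ℝ)
  have hg : ∀ A H, g A H ≠ 0 → ∃ U ∈ 𝓕, fH U = H.1 ∧ fA U = A.1 := by
    intro A H h
    have : ((𝓕.filter (fun U => fH U = H.1)).filter (fun U => fA U = A.1)).card ≠ 0 := by
      intro e; apply h; simp only [g, e, Nat.cast_zero]
    obtain ⟨U, hU⟩ := Finset.card_ne_zero.1 this
    simp only [Finset.mem_filter] at hU
    exact ⟨U, hU.1.1, hU.1.2, hU.2⟩
  have hAH : ∀ H : {H : Submodule K (Fin (2*k) → K) // finrank K H + 1 = 2*k},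
      ∑ A, g A H = ((𝓕.filter (fun U => fH U = H.1)).card : ℝ) := fun H =>
    fib_one _ fA (fun U h => hA U (Finset.mem_filter.1 h).1)
  have htot : ∑ A, ∑ H, g A H = (𝓕.card : ℝ) := by
    rw [Finset.sum_comm]
    simp only [hAH]
    exact fib_one _ fH hH
  rw [← htot]
  refine I3 hk (by simp) g (fun A H => Nat.cast_nonneg _) ?_ ?_ ?_
  · intro A H h
    obtain ⟨U, hU, e1, e2⟩ := hg A H h
    rw [← e1, ← e2]
    exact Submodule.map_mono (le_Hp π U)
  · intro A H A' H' h h'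
    obtain ⟨U, hU, e1, e2⟩ := hg A H h
    obtain ⟨U', hU', e1', e2'⟩ := hg A' H' h'
    obtain ⟨x, hx, hn⟩ := hint U hU U' hU'
    rw [← e2, ← e2']
    intro hb
    apply hn
    have : piV π _ x ∈ fA U ⊓ fA U' := ⟨⟨x, hx.1, rfl⟩, ⟨x, hx.2, rfl⟩⟩
    rw [hb] at this
    exact this
  · rw [Finset.sum_comm, Finset.sum_comm (f := fun A H => g A H), Finset.mul_sum, Finset.mul_sum, Finset.mul_sum,
      ← Finset.sum_add_distrib]
    refine Finset.sum_le_sum fun H _ => ?_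
    rw [hAH]
    have e := fib_two (p := isK K k) (𝓕.filter (fun U => fH U = H.1)) fA
      (fun U h => hA U (Finset.mem_filter.1 h).1)
    change _ * ∑ A, g A H ^ 2 + _ ≤ _
    rw [show ∑ A, g A H ^ 2 = _ from e]
    refine class_bound D hk (𝓕.filter (fun U => fH U = H.1)) (fun U h => hc U (Finset.mem_filter.1 h).1)
      (fun U h => hc' U (Finset.mem_filter.1 h).1)
      (fun U h U' h' => hint U (Finset.mem_filter.1 h).1 U' (Finset.mem_filter.1 h').1)
      (H.1.comap (piV π _)) ?_
    intro U h
    rw [← (Finset.mem_filter.1 h).2]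
    simp only [fH, Submodule.comap_map_eq]
    exact (sup_eq_left.2 (Z_le_Hp D U)).symm

end ringside
end EKR

namespace EKR
open Module

section inst
set_option linter.unusedSectionVars false
universe u
variable {R : Type u} [Ring R] [Finite R]

theorem unit_of_notMem (hchain : ∀ I J : Ideal R, I ≤ J ∨ J ≤ I) {N : Ideal R} (hN : N.IsMaximal)
    {r : R} (hr : r ∉ N) : IsUnit r := by
  rcases hchain N (Ideal.span {r}) with h | h
  · have : Ideal.span {r} = ⊤ := by
      apply hN.1.2
      refine lt_of_le_of_ne h ?_
      rintro rfl
      exact hr (Ideal.mem_span_singleton_self r)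
    have h1 : (1 : R) ∈ Ideal.span {r} := by rw [this]; trivial
    obtain ⟨s, hs⟩ := Ideal.mem_span_singleton'.1 h1
    exact IsUnit.of_mul_eq_one_right s hs
  · exact absurd (h (Ideal.mem_span_singleton_self r)) hr

theorem notMem_of_unit {N : Ideal R} (hN : N.IsMaximal) {r : R} (hr : IsUnit r) : r ∉ N :=
  fun h => hN.ne_top (Ideal.eq_top_of_isUnit_mem N h hr)

theorem exists_field (hchain : ∀ I J : Ideal R, I ≤ J ∨ J ≤ I) {N : Ideal R} (hN : N.IsMaximal) :
    ∃ (K : Type u) (_ : Field K) (_ : Finite K) (π : R →+* K),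
      Function.Surjective π ∧ (∀ r, π r = 0 ↔ r ∈ N) ∧ Nat.card K = Nat.card (R ⧸ N) := by
  have h2 : N.IsTwoSided := by
    constructor
    intro a b ha
    by_contra hab
    obtain ⟨u, hu⟩ := unit_of_notMem hchain hN hab
    refine notMem_of_unit hN ?_ ha
    refine IsUnit.of_mul_eq_one (b * (u⁻¹ : Rˣ)) ?_
    rw [← mul_assoc, ← hu, Units.mul_inv]
  have hnt : Nontrivial (R ⧸ N) := by
    refine ⟨Ideal.Quotient.mk N 1, 0, ?_⟩
    rw [Ne, Ideal.Quotient.eq_zero_iff_mem]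
    exact notMem_of_unit hN isUnit_one
  have hfin : Finite (R ⧸ N) := Finite.of_surjective _ Ideal.Quotient.mk_surjective
  let dr : DivisionRing (R ⧸ N) := DivisionRing.ofIsUnitOrEqZero (by
    intro x
    obtain ⟨r, rfl⟩ := Ideal.Quotient.mk_surjective x
    by_cases hr : r ∈ N
    · right; exact Ideal.Quotient.eq_zero_iff_mem.2 hr
    · left; exact (unit_of_notMem hchain hN hr).map _)
  let fd : Field (R ⧸ N) := littleWedderburn (R ⧸ N)
  exact ⟨R ⧸ N, fd, hfin, Ideal.Quotient.mk N, Ideal.Quotient.mk_surjective,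
    fun r => Ideal.Quotient.eq_zero_iff_mem, rfl⟩

theorem card_top_split {A : Type*} [AddCommGroup A] (f : A →+ A) :
    Nat.card A = Nat.card f.range * Nat.card f.ker := by
  have := card_split f ⊤
  rw [top_inf_eq, ← AddMonoidHom.range_eq_map] at this
  rw [← this]
  exact (Nat.card_congr AddSubgroup.topEquiv.toEquiv).symm

theorem exists_theta (hchain : ∀ I J : Ideal R, I ≤ J ∨ J ≤ I) {N : Ideal R} (hN : N.IsMaximal)
    (hN2 : ∀ a ∈ N, ∀ b ∈ N, a * b = 0) (hNne : N ≠ ⊥) {K : Type*} [Field K]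
    (π : R →+* K) (hπ : ∀ r, π r = 0 ↔ r ∈ N) :
    ∃ θ ∈ N, θ ≠ 0 ∧ ChainData π θ ∧ Nat.card R = Nat.card N * Nat.card N := by
  obtain ⟨θ, hθ, h0⟩ := Submodule.exists_mem_ne_zero_of_ne_bot hNne
  have hl : ∀ r, θ * r = 0 ↔ r ∈ N := by
    intro r
    constructor
    · intro h
      by_contra hr
      obtain ⟨u, rfl⟩ := unit_of_notMem hchain hN hr
      exact h0 ((Units.mul_left_eq_zero u).1 h)
    · exact hN2 θ hθ r
  have hr : ∀ r, r * θ = 0 ↔ r ∈ N := by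
    intro r
    constructor
    · intro h
      by_contra hr
      obtain ⟨u, rfl⟩ := unit_of_notMem hchain hN hr
      exact h0 ((Units.mul_right_eq_zero u).1 h)
    · exact fun h => hN2 r h θ hθ
  have hexl : ∀ n ∈ N, ∃ r, n = r * θ := by
    intro n hn
    rcases hchain (Ideal.span {n}) (Ideal.span {θ}) with h | h
    · obtain ⟨s, hs⟩ := Ideal.mem_span_singleton'.1 (h (Ideal.mem_span_singleton_self n))
      exact ⟨s, hs.symm⟩
    · obtain ⟨s, hs⟩ := Ideal.mem_span_singleton'.1 (h (Ideal.mem_span_singleton_self θ))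
      have : s ∉ N := fun hsN => h0 (by rw [← hs]; exact hN2 s hsN n hn)
      obtain ⟨u, rfl⟩ := unit_of_notMem hchain hN this
      exact ⟨(u⁻¹ : Rˣ), by rw [← hs, Units.inv_mul_cancel_left]⟩
  have k1 : (AddMonoidHom.mulLeft θ).ker = N.toAddSubgroup := by
    ext r; exact hl r
  have k2 : (AddMonoidHom.mulRight θ).ker = N.toAddSubgroup := by
    ext r; exact hr r
  have r2 : (AddMonoidHom.mulRight θ).range = N.toAddSubgroup := by
    ext r
    constructor
    · rintro ⟨s, rfl⟩
      exact N.mul_mem_left s hθ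
    · intro h
      obtain ⟨s, hs⟩ := hexl r h
      exact ⟨s, hs.symm⟩
  have c1 := card_top_split (AddMonoidHom.mulLeft θ)
  have c2 := card_top_split (AddMonoidHom.mulRight θ)
  rw [k1] at c1
  rw [k2, r2] at c2
  have hpos : 0 < Nat.card N.toAddSubgroup := Nat.card_pos
  have c3 := Nat.eq_of_mul_eq_mul_right hpos (c1.symm.trans c2)
  have r1 : (AddMonoidHom.mulLeft θ).range = N.toAddSubgroup := by
    apply SetLike.coe_injective
    refine Set.eq_of_subset_of_ncard_le ?_ c3.ge
    rintro _ ⟨s, rfl⟩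
    change θ * s ∈ N
    have : π (θ * s) = 0 := by rw [map_mul, (hπ θ).2 hθ, zero_mul]
    exact (hπ _).1 this
  refine ⟨θ, hθ, h0, ⟨fun r => (hl r).trans (hπ r).symm, fun n hn => hexl n ((hπ n).1 hn), ?_, (hπ θ).2 hθ⟩, c2⟩
  intro n hn
  have : n ∈ (AddMonoidHom.mulLeft θ).range := by rw [r1]; exact (hπ n).1 hn
  obtain ⟨s, hs⟩ := this
  exact ⟨s, hs.symm⟩

theorem card_quot {N : Ideal R} : Nat.card R = Nat.card (R ⧸ N) * Nat.card N :=
  AddSubgroup.card_eq_card_quotient_mul_card_addSubgroup N.toAddSubgroup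

theorem card_inf {N : Ideal R} {K : Type*} [Field K] [Finite K] {π : R →+* K} [RingHomSurjective π]
    (hπ : ∀ r, π r = 0 ↔ r ∈ N) {θ : R} (hθ : θ ∈ N) (D : ChainData π θ) {a b m : ℕ}
    (U : Submodule R (Fin m → R)) (e : U ≃ₗ[R] ((Fin a → R) × (Fin b → R ⧸ N))) :
    Nat.card (U ⊓ Zs π m : Submodule R (Fin m → R)) = Nat.card N ^ a * Nat.card (R ⧸ N) ^ b := by
  have hZ : ∀ v : Fin m → R, v ∈ Zs π m ↔ θ • v = 0 := by
    intro v
    rw [mem_Zs, funext_iff]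
    exact forall_congr' fun i => (D.left (v i)).symm
  let e1 : (U ⊓ Zs π m : Submodule R (Fin m → R)) ≃ {u : U // θ • u = 0} :=
    ⟨fun u => ⟨⟨u.1, u.2.1⟩, Subtype.ext ((hZ _).1 u.2.2)⟩,
      fun u => ⟨u.1.1, u.1.2, (hZ _).2 (congrArg Subtype.val u.2)⟩, fun _ => rfl, fun _ => rfl⟩
  let e2 : {u : U // θ • u = 0} ≃ {p : (Fin a → R) × (Fin b → R ⧸ N) // θ • p = 0} :=
    e.toEquiv.subtypeEquiv (fun u => by
      change _ ↔ θ • e u = 0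
      rw [← map_smul, LinearEquiv.map_eq_zero_iff])
  have h2 : ∀ x : Fin b → R ⧸ N, θ • x = 0 := by
    intro x
    ext i
    change θ • x i = 0
    obtain ⟨r, hr⟩ := Submodule.mkQ_surjective N (x i)
    rw [← hr, ← map_smul]
    refine (Submodule.Quotient.mk_eq_zero N).2 ?_
    rw [← hπ, smul_eq_mul, map_mul, D.th, zero_mul]
  let e3 : {p : (Fin a → R) × (Fin b → R ⧸ N) // θ • p = 0} ≃ (Fin a → N) × (Fin b → R ⧸ N) :=
    ⟨fun p => (fun i => ⟨p.1.1 i, (hπ _).1 ((D.left _).1 (congrFun (congrArg Prod.fst p.2) i))⟩, p.1.2),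
      fun p => ⟨(fun i => (p.1 i).1, p.2), Prod.ext (funext fun i => (D.left _).2 ((hπ _).2 (p.1 i).2)) (h2 _)⟩,
      fun _ => rfl, fun _ => rfl⟩
  rw [Nat.card_congr (e1.trans (e2.trans e3)), Nat.card_prod, Nat.card_fun, Nat.card_fun, Nat.card_fin, Nat.card_fin]

theorem final (q k : ℕ)
    (hchain : ∀ I J : Ideal R, I ≤ J ∨ J ≤ I)
    (N : Ideal R) (hN : N.IsMaximal)
    (hN2 : ∀ a ∈ N, ∀ b ∈ N, a * b = 0) (hNne : N ≠ ⊥)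
    (hq : Nat.card (R ⧸ N) = q)
    (hk : 1 ≤ k)
    (𝓕 : Finset (Submodule R (Fin (2 * k) → R)))
    (hshape : ∀ U ∈ 𝓕, Nonempty (U ≃ₗ[R] ((Fin k → R) × (Fin (k - 1) → R ⧸ N))))
    (hint : ∀ U ∈ 𝓕, ∀ U' ∈ 𝓕, ∃ P : Submodule R (Fin (2 * k) → R),
      P ≤ U ⊓ U' ∧ Nonempty (P ≃ₗ[R] R)) :
    𝓕.card ≤ (q ^ (k + 1) * gaussBinom q (k - 1) 1 + 1) * gaussBinom q (2 * k - 1) (k - 1) := by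
  obtain ⟨K, _, _, π, hsurj, hπ, hK⟩ := exists_field hchain hN
  obtain ⟨θ, hθ, h0, D, hR⟩ := exists_theta hchain hN hN2 hNne π hπ
  have : RingHomSurjective π := ⟨hsurj⟩
  have hNq : Nat.card N = q := by
    have := hR.symm.trans (card_quot (N := N))
    rw [← hq]
    exact Nat.eq_of_mul_eq_mul_right Nat.card_pos this
  rw [hq] at hK
  have hRq : Nat.card R = q ^ 2 := by rw [hR, hNq, sq]
  have hc : ∀ U ∈ 𝓕, Nat.card U = q ^ (3*k-1) := by
    intro U h
    obtain ⟨e⟩ := hshape U h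
    rw [Nat.card_congr e.toEquiv, Nat.card_prod, Nat.card_fun, Nat.card_fun, Nat.card_fin, Nat.card_fin,
      hRq, hq, ← pow_mul, ← pow_add]
    congr 1; omega
  rcases Nat.lt_or_ge k 2 with hk1 | hk2
  · obtain rfl : k = 1 := by omega
    have h1 : 𝓕.card ≤ 1 := by
      have key : ∀ U ∈ 𝓕, ∀ P : Submodule R (Fin (2 * 1) → R), P ≤ U → Nonempty (P ≃ₗ[R] R) → P = U := by
        rintro U h P hP ⟨e⟩
        apply SetLike.coe_injective
        refine Set.eq_of_subset_of_ncard_le hP ?_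
        change Nat.card U ≤ Nat.card P
        rw [hc U h, Nat.card_congr e.toEquiv, hRq]
      rw [Finset.card_le_one]
      intro U h U' h'
      obtain ⟨P, hP, e⟩ := hint U h U' h'
      rw [← key U h P (hP.trans inf_le_left) e, ← key U' h' P (hP.trans inf_le_right) e]
    refine h1.trans ?_
    simp [gaussBinom]
  · have hq2 : 2 ≤ q := by rw [← hK]; exact Finite.one_lt_card
    have := abs_main D hk2 𝓕 (by rw [hK]; exact hc) ?_ ?_
    · rw [hK] at this
      have hg : gaussBinom q (k-1) 1 = gI q (k-1) := by
        have h := gI_mul q (k-1)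
        have h' : (q - 1) * gI q (k-1) = q^(k-1) - 1 := by
          have : 1 ≤ q ^ (k-1) := Nat.one_le_pow _ _ (by omega)
          rify [this, (by omega : 1 ≤ q)]
          exact h
        simp only [gaussBinom, Finset.prod_range_one, Nat.sub_zero, pow_one]
        rw [← h', Nat.mul_div_cancel_left _ (by omega)]
      have hgk : gI q k = 1 + q * gI q (k-1) := by
        have := gI_add q 1 (k-1)
        rw [show 1 + (k-1) = k by omega] at this
        rw [this]; simp [gI]
      rw [hg]
      have h3 : (𝓕.card : ℝ) ≤ (((q ^ (k + 1) * gI q (k - 1) + 1) * gaussBinom q (2 * k - 1) (k - 1) : ℕ) : ℝ) := by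
        refine this.trans (le_of_eq ?_)
        rw [hgk]; push_cast; ring
      exact_mod_cast h3
    · intro U h
      obtain ⟨e⟩ := hshape U h
      rw [card_inf hπ hθ D U e, hNq, hq, hK, ← pow_add]
      congr 1; omega
    · intro U h U' h'
      obtain ⟨P, hP, ⟨e⟩⟩ := hint U h U' h'
      refine ⟨(e.symm 1).1, hP (e.symm 1).2, ?_⟩
      intro hz
      have h1 : θ • (e.symm 1).1 = 0 := smul_Z D D.th hz
      have h2 : θ • e.symm 1 = 0 := Subtype.ext h1
      have h3 := congrArg e h2
      rw [map_smul, LinearEquiv.apply_symm_apply, map_zero, smul_eq_mul, mul_one] at h3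
      exact h0 h3
end inst
end EKR

/-- **Bound for intersecting families of shape `2^k 1^{k-1}` subspaces of
`PHG(2k-1,R)`.** Let `R` be a finite chain ring of length 2 (its left ideals form a
chain, its maximal ideal `N` satisfies `N² = 0`, `N ≠ 0`, and `R/N ≅ F_q`), let `k ≥ 1`
and `n = 2k`. If `𝓕` is a family of submodules of `R^{2k}`, each of shape `2^k 1^{k-1}`
(isomorphic to `R^k ⊕ (R/N)^{k-1}`), such that any two members of `𝓕` contain a common
free rank-1 submodule, then
`|𝓕| ≤ (q^{k+1} · (q^{k-1}-1)/(q-1) + 1) · [2k-1 choose k-1]_q`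
(here `(q^{k-1}-1)/(q-1) = [k-1 choose 1]_q`). -/
theorem ekr_shape_2k1km1_bound (q k : ℕ) {R : Type*} [Ring R] [Fintype R]
    (hchain : ∀ I J : Ideal R, I ≤ J ∨ J ≤ I)
    (N : Ideal R) (hN : N.IsMaximal)
    (hN2 : ∀ a ∈ N, ∀ b ∈ N, a * b = 0) (hNne : N ≠ ⊥)
    (hq : Nat.card (R ⧸ N) = q) (hq' : IsPrimePow q)
    (hk : 1 ≤ k)
    (𝓕 : Finset (Submodule R (Fin (2 * k) → R)))
    (hshape : ∀ U ∈ 𝓕, Nonempty (U ≃ₗ[R] ((Fin k → R) × (Fin (k - 1) → R ⧸ N))))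
    (hint : ∀ U ∈ 𝓕, ∀ U' ∈ 𝓕, ∃ P : Submodule R (Fin (2 * k) → R),
      P ≤ U ⊓ U' ∧ Nonempty (P ≃ₗ[R] R)) :
    𝓕.card ≤ (q ^ (k + 1) * gaussBinom q (k - 1) 1 + 1) * gaussBinom q (2 * k - 1) (k - 1) := by
  exact EKR.final q k hchain N hN hN2 hNne hq hk 𝓕 hshape hint
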